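/- arXiv:2403.19089 — 2 statements merged into one kernel-verified Lean document; each statement's English description precedes it below -/
import Mathlib

section
/- Let n ≥ 3 and let f : S^{n-1} → ℝ be a function with Lipschitz constant at most 1 with respect to the Euclidean distance, and let m = ∫_{S^{n-1}} f dσ_{n-1}. Then for every r > 0, σ_{n-1}{θ ∈ S^{n-1} : |f(θ) - m| ≥ r} ≤ (1/r) · e^{-(n-2)r²/2} · ∫_{S^{n-1}} |f - m| dσ_{n-1}. -/
open MeasureTheory Real

/-- The standard Gaussian measure on `ℝⁿ`. -/
noncomputable def stdGaussian (n : ℕ) : Measure (EuclideanSpace ℝ (Fin n)) :=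
  volume.withDensity fun x =>
    ENNReal.ofReal ((2 * π) ^ (-(n : ℝ) / 2) * Real.exp (-‖x‖ ^ 2 / 2))

/-- The uniform (rotation-invariant) probability measure on the unit sphere `S^{n-1}`,
realized as the image of the standard Gaussian measure under `x ↦ x/‖x‖`. -/
noncomputable def sphereUniform (n : ℕ) : Measure (EuclideanSpace ℝ (Fin n)) :=
  (stdGaussian n).map fun x => ‖x‖⁻¹ • x

lemma gauss_dens_integrable (n : ℕ) : Integrable (fun x : EuclideanSpace ℝ (Fin n) =>
    (2 * π) ^ (-(n : ℝ) / 2) * Real.exp (-‖x‖ ^ 2 / 2)) := by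
  have h := GaussianFourier.integrable_cexp_neg_mul_sq_norm_add (V := EuclideanSpace ℝ (Fin n))
    (b := 1/2) (by norm_num) 0 0
  have h2 := h.norm
  refine (h2.congr ?_).const_mul _
  filter_upwards with x
  rw [Complex.norm_exp]
  congr 1
  simp [← Complex.ofReal_pow]
  ring

instance gauss_fin (n : ℕ) : IsFiniteMeasure (stdGaussian n) := by
  unfold stdGaussian
  exact isFiniteMeasure_withDensity_ofReal (gauss_dens_integrable n).2

lemma gauss_integral {n : ℕ} {F : Type*} [NormedAddCommGroup F] [NormedSpace ℝ F]
    (g : EuclideanSpace ℝ (Fin n) → F) :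
    ∫ x, g x ∂(stdGaussian n) =
      ∫ x, ((2 * π) ^ (-(n : ℝ) / 2) * Real.exp (-‖x‖ ^ 2 / 2)) • g x := by
  unfold stdGaussian
  rw [integral_withDensity_eq_integral_toReal_smul (by fun_prop) (by simp)]
  congr 1 with x
  rw [ENNReal.toReal_ofReal (by positivity)]

lemma gauss_eq (n : ℕ) : stdGaussian n =
    ProbabilityTheory.stdGaussian (EuclideanSpace ℝ (Fin n)) := by
  apply Measure.ext_of_charFun
  ext t
  rw [ProbabilityTheory.charFun_stdGaussian, charFun_apply, gauss_integral]
  have h := GaussianFourier.integral_cexp_neg_mul_sq_norm_add (V := EuclideanSpace ℝ (Fin n))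
    (b := 1/2) (by norm_num) Complex.I t
  have e : ∀ x : EuclideanSpace ℝ (Fin n), ((2 * π) ^ (-(n : ℝ) / 2) * Real.exp (-‖x‖ ^ 2 / 2)) •
      Complex.exp ((inner ℝ x t : ℝ) * Complex.I) = ((2 * π) ^ (-(n : ℝ) / 2) : ℝ) *
      Complex.exp (-(1/2) * ‖x‖ ^ 2 + Complex.I * (inner ℝ t x : ℝ)) := by
    intro x
    rw [Complex.exp_add, real_inner_comm, Complex.real_smul]
    push_cast
    rw [mul_assoc]
    congr 2
    · congr 1; ring
    · rw [mul_comm]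
  simp_rw [e]
  rw [integral_const_mul, h]
  have e2 : (π / (1/2) : ℂ) ^ ((Module.finrank ℝ (EuclideanSpace ℝ (Fin n)) : ℂ) / 2)
      = (((2 * π) ^ ((n : ℝ) / 2) : ℝ) : ℂ) := by
    rw [Complex.ofReal_cpow (by positivity)]
    simp
    congr 1; ring
  rw [e2, ← mul_assoc, ← Complex.ofReal_mul, ← Real.rpow_add (by positivity)]
  have : -(n : ℝ) / 2 + n / 2 = 0 := by ring
  rw [this]
  simp
  congr 1
  ring

instance gauss_prob (n : ℕ) : IsProbabilityMeasure (stdGaussian n) := by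
  rw [gauss_eq]; infer_instance

instance gauss_gauss (n : ℕ) : ProbabilityTheory.IsGaussian (stdGaussian n) := by
  rw [gauss_eq]; infer_instance

lemma gauss_isom {n : ℕ} (U : EuclideanSpace ℝ (Fin n) ≃ₗᵢ[ℝ] EuclideanSpace ℝ (Fin n)) :
    MeasurePreserving U (stdGaussian n) (stdGaussian n) := by
  refine ⟨U.continuous.measurable, ?_⟩
  rw [gauss_eq]
  exact ProbabilityTheory.stdGaussian_map U

lemma gauss_rot {n : ℕ} (θ : ℝ) :
    MeasurePreserving (fun p : EuclideanSpace ℝ (Fin n) × EuclideanSpace ℝ (Fin n) =>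
      (cos θ • p.1 + sin θ • p.2, -sin θ • p.1 + cos θ • p.2))
      ((stdGaussian n).prod (stdGaussian n)) ((stdGaussian n).prod (stdGaussian n)) := by
  refine ⟨by fun_prop, ?_⟩
  have h := ProbabilityTheory.IsGaussian.map_rotation_eq_self_of_forall_strongDual_eq_zero
    (μ := stdGaussian n) (fun L => by
      rw [gauss_eq]; exact ProbabilityTheory.integral_strongDual_stdGaussian L) θ
  have e : (fun p : EuclideanSpace ℝ (Fin n) × EuclideanSpace ℝ (Fin n) =>
      (cos θ • p.1 + sin θ • p.2, -sin θ • p.1 + cos θ • p.2)) =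
      ⇑(ContinuousLinearMap.rotation θ) := by
    ext p : 1
    rw [ContinuousLinearMap.rotation_apply]
  rw [e]
  exact h

lemma gauss_ac (n : ℕ) : stdGaussian n ≪ volume := withDensity_absolutelyContinuous _ _

lemma gauss_norm_int (n : ℕ) : Integrable (fun x => ‖x‖) (stdGaussian n) :=
  (ProbabilityTheory.IsGaussian.integrable_id (μ := stdGaussian n)).norm

lemma gauss_integrable_iff {n : ℕ} (g : EuclideanSpace ℝ (Fin n) → ℝ) :
    Integrable g (stdGaussian n) ↔ Integrable
      (fun x => ((2 * π) ^ (-(n : ℝ) / 2) * Real.exp (-‖x‖ ^ 2 / 2)) * g x) := by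
  unfold stdGaussian
  rw [integrable_withDensity_iff_integrable_smul' (by fun_prop) (by simp)]
  apply integrable_congr
  filter_upwards with x
  rw [ENNReal.toReal_ofReal (by positivity)]; rfl

lemma gauss_inv_norm_int {n : ℕ} (hn : 3 ≤ n) :
    Integrable (fun x => ‖x‖⁻¹) (stdGaussian n) := by
  rw [gauss_integrable_iff]
  have : Nonempty (Fin n) := ⟨⟨0, by omega⟩⟩
  have h := (integrable_fun_norm_addHaar (volume : Measure (EuclideanSpace ℝ (Fin n)))
    (f := fun y => ((2 * π) ^ (-(n : ℝ) / 2) * Real.exp (-y ^ 2 / 2)) * y⁻¹))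
  apply h.2
  have h2 := (integrableOn_rpow_mul_exp_neg_mul_sq (b := 1/2) (s := (n : ℝ) - 2) (by norm_num)
    (by have : (3 : ℝ) ≤ n := by exact_mod_cast hn
        linarith)).const_mul ((2 * π) ^ (-(n : ℝ) / 2))
  refine IntegrableOn.congr_fun h2 ?_ measurableSet_Ioi
  intro y hy
  have hy : 0 < y := hy
  simp only [finrank_euclideanSpace, Fintype.card_fin, smul_eq_mul]
  have e1 : (n : ℝ) - 2 = ((n - 2 : ℕ) : ℝ) := by
    rw [Nat.cast_sub (by omega)]; simp
  have e2 : n - 1 = (n - 2) + 1 := by omega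
  rw [e1, Real.rpow_natCast, e2, pow_succ y (n-2)]
  have e3 : -(1/2) * y ^ 2 = - y^2 / 2 := by ring
  rw [e3]
  field_simp

lemma gauss_polar_aux {n : ℕ} (hn : 3 ≤ n) (φ : EuclideanSpace ℝ (Fin n) → ℝ) (ψ : ℝ → ℝ) :
    ∫ x, φ (‖x‖⁻¹ • x) * ψ ‖x‖ ∂(volume : Measure (EuclideanSpace ℝ (Fin n))) =
    (∫ x : Metric.sphere (0 : EuclideanSpace ℝ (Fin n)) 1, φ x
      ∂(volume : Measure (EuclideanSpace ℝ (Fin n))).toSphere) *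
    ∫ y : Set.Ioi (0:ℝ), ψ y ∂(.volumeIoiPow
      (Module.finrank ℝ (EuclideanSpace ℝ (Fin n)) - 1)) := by
  have : Nonempty (Fin n) := ⟨⟨0, by omega⟩⟩
  set μ := (volume : Measure (EuclideanSpace ℝ (Fin n)))
  calc ∫ x, φ (‖x‖⁻¹ • x) * ψ ‖x‖ ∂μ
      = ∫ x : ({(0)}ᶜ : Set (EuclideanSpace ℝ (Fin n))), φ (‖x.1‖⁻¹ • x.1) * ψ (‖x.1‖)
        ∂(μ.comap (↑)) := by
        rw [integral_subtype_comap (measurableSet_singleton _).compl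
          fun x : EuclideanSpace ℝ (Fin n) ↦ φ (‖x‖⁻¹ • x) * ψ ‖x‖,
          restrict_compl_singleton]
    _ = ∫ x, φ x.1 * ψ x.2 ∂μ.toSphere.prod (.volumeIoiPow
      (Module.finrank ℝ (EuclideanSpace ℝ (Fin n)) - 1)) := by
      have := μ.measurePreserving_homeomorphUnitSphereProd.integral_comp
        (Homeomorph.measurableEmbedding _) (fun x => φ x.1 * ψ x.2)
      simpa using this
    _ = _ := integral_prod_mul (L := ℝ)
        (fun x : Metric.sphere (0 : EuclideanSpace ℝ (Fin n)) 1 => φ x)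
        (fun y : Set.Ioi (0:ℝ) => ψ y)

/-- Independence of the direction and of the norm. -/
lemma gauss_polar {n : ℕ} (hn : 3 ≤ n) (φ : EuclideanSpace ℝ (Fin n) → ℝ) (ψ : ℝ → ℝ) :
    ∫ x, φ (‖x‖⁻¹ • x) * ψ ‖x‖ ∂(stdGaussian n) =
    (∫ x, φ (‖x‖⁻¹ • x) ∂(stdGaussian n)) * ∫ x, ψ ‖x‖ ∂(stdGaussian n) := by
  obtain ⟨A, B, key⟩ : ∃ (A : (EuclideanSpace ℝ (Fin n) → ℝ) → ℝ) (B : (ℝ → ℝ) → ℝ),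
      ∀ φ ψ, ∫ x, φ (‖x‖⁻¹ • x) * ψ ‖x‖ ∂(stdGaussian n) = A φ * B ψ := by
    refine ⟨fun φ => ∫ x : Metric.sphere (0 : EuclideanSpace ℝ (Fin n)) 1, φ x
      ∂(volume : Measure (EuclideanSpace ℝ (Fin n))).toSphere,
      fun ψ => ∫ y : Set.Ioi (0:ℝ), ((2 * π) ^ (-(n : ℝ) / 2) * Real.exp (-(y:ℝ) ^ 2 / 2)) * ψ y
        ∂(.volumeIoiPow (Module.finrank ℝ (EuclideanSpace ℝ (Fin n)) - 1)), fun φ ψ => ?_⟩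
    rw [gauss_integral]
    exact (integral_congr_ae (by filter_upwards with x; rw [smul_eq_mul]; ring)).trans
      (gauss_polar_aux hn φ (fun y => ((2 * π) ^ (-(n : ℝ) / 2) * Real.exp (-y ^ 2 / 2)) * ψ y))
  have h1 := key φ ψ
  have h2 := key φ (fun _ => 1)
  have h3 := key (fun _ => 1) ψ
  have h4 := key (fun _ => 1) (fun _ => 1)
  simp only [mul_one, one_mul, integral_const, probReal_univ, smul_eq_mul] at h1 h2 h3 h4
  rw [h1, h2, h3]
  linear_combination (A φ * B ψ) * h4

/-- Radial projection to the unit sphere. -/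
noncomputable def nrm {n : ℕ} (x : EuclideanSpace ℝ (Fin n)) : EuclideanSpace ℝ (Fin n) :=
  ‖x‖⁻¹ • x

/-- `H` is Lipschitz as a function of the direction. -/
def DirLip {n : ℕ} (H : EuclideanSpace ℝ (Fin n) → ℝ) (L : ℝ) : Prop :=
  0 ≤ L ∧ ∀ x y, x ≠ 0 → y ≠ 0 → |H x - H y| ≤ L * ‖nrm x - nrm y‖

lemma nrm_norm {n : ℕ} {x : EuclideanSpace ℝ (Fin n)} (hx : x ≠ 0) : ‖nrm x‖ = 1 := by
  have : ‖x‖ ≠ 0 := norm_ne_zero_iff.2 hx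
  simp [nrm, norm_smul, this]

lemma nrm_norm_le {n : ℕ} (x : EuclideanSpace ℝ (Fin n)) : ‖nrm x‖ ≤ 1 := by
  by_cases hx : x = 0
  · simp [nrm, hx]
  · exact (nrm_norm hx).le

lemma nrm_sub_sq {n : ℕ} {x y : EuclideanSpace ℝ (Fin n)} (hx : x ≠ 0) (hy : y ≠ 0) :
    ‖nrm x - nrm y‖ ^ 2 * (‖x‖ * ‖y‖) ≤ ‖x - y‖ ^ 2 := by
  have h1 : 0 < ‖x‖ := norm_pos_iff.2 hx
  have h2 : 0 < ‖y‖ := norm_pos_iff.2 hy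
  rw [norm_sub_sq_real, norm_sub_sq_real, nrm_norm hx, nrm_norm hy]
  simp only [nrm, real_inner_smul_left, real_inner_smul_right]
  have : (1 ^ 2 - 2 * (‖y‖⁻¹ * (‖x‖⁻¹ * inner ℝ x y)) + 1 ^ 2) * (‖x‖ * ‖y‖)
    = 2 * (‖x‖ * ‖y‖) - 2 * inner ℝ x y := by
    field_simp; ring
  rw [this]
  nlinarith [sq_nonneg (‖x‖ - ‖y‖)]

lemma nrm_lip {n : ℕ} {ρ : ℝ} (hρ : 0 < ρ) {x y : EuclideanSpace ℝ (Fin n)} (hx : ρ ≤ ‖x‖)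
    (hy : ρ ≤ ‖y‖) : ‖nrm x - nrm y‖ ≤ ‖x - y‖ / ρ := by
  have h := nrm_sub_sq (norm_pos_iff.1 (hρ.trans_le hx)) (norm_pos_iff.1 (hρ.trans_le hy))
  rw [le_div_iff₀ hρ]
  apply le_of_sq_le_sq _ (norm_nonneg _)
  refine le_trans ?_ h
  rw [mul_pow]
  gcongr
  nlinarith

lemma nrm_smul {n : ℕ} {t : ℝ} (ht : 0 < t) (x : EuclideanSpace ℝ (Fin n)) :
    nrm (t • x) = nrm x := by
  simp only [nrm, norm_smul, smul_smul, Real.norm_of_nonneg ht.le, mul_inv]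
  congr 1
  field_simp

namespace DirLip

variable {n : ℕ} {H : EuclideanSpace ℝ (Fin n) → ℝ} {L : ℝ}

lemma lipOn (h : DirLip H L) {ρ : ℝ} (hρ : 0 < ρ) :
    LipschitzOnWith (L / ρ).toNNReal H {x | ρ ≤ ‖x‖} := by
  apply LipschitzOnWith.of_dist_le_mul
  intro x hx y hy
  have hx' : ρ ≤ ‖x‖ := hx
  have hy' : ρ ≤ ‖y‖ := hy
  rw [Real.coe_toNNReal _ (div_nonneg h.1 hρ.le), Real.dist_eq, dist_eq_norm]
  refine (h.2 x y (norm_pos_iff.1 (hρ.trans_le hx)) (norm_pos_iff.1 (hρ.trans_le hy))).trans ?_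
  calc _ ≤ L * (‖x - y‖ / ρ) := mul_le_mul_of_nonneg_left (nrm_lip hρ hx' hy') h.1
    _ = _ := by ring

lemma nhds_mem {x : EuclideanSpace ℝ (Fin n)} {ρ : ℝ} (hx : ρ < ‖x‖) :
    {x : EuclideanSpace ℝ (Fin n) | ρ ≤ ‖x‖} ∈ nhds x := by
  have : IsOpen {x : EuclideanSpace ℝ (Fin n) | ρ < ‖x‖} := isOpen_lt (by fun_prop) (by fun_prop)
  filter_upwards [this.mem_nhds hx] with y hy using le_of_lt hy

lemma measurable (h : DirLip H L) : Measurable H := by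
  apply measurable_of_continuousOn_compl_singleton 0
  intro x hx
  have h0 : 0 < ‖x‖ := norm_pos_iff.2 hx
  exact ((h.lipOn (half_pos h0)).continuousOn.continuousAt
    (nhds_mem (by linarith))).continuousWithinAt

lemma bounded (h : DirLip H L) : ∃ B, ∀ x, |H x| ≤ B := by
  by_cases hx : ∃ x : EuclideanSpace ℝ (Fin n), x ≠ 0
  · obtain ⟨x, hx⟩ := hx
    refine ⟨max |H 0| (|H x| + L * 2), fun y => ?_⟩
    by_cases hy : y = 0
    · simp [hy]
    · apply le_max_of_le_right
      have h1 := h.2 y x hy hx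
      have h2 : ‖nrm y - nrm x‖ ≤ 2 := by
        have := norm_sub_le (nrm y) (nrm x)
        rw [nrm_norm hy, nrm_norm hx] at this
        linarith
      have h3 := mul_le_mul_of_nonneg_left h2 h.1
      have h4 := abs_add_le (H y - H x) (H x)
      rw [sub_add_cancel] at h4
      linarith
  · push Not at hx
    exact ⟨|H 0|, fun y => by rw [hx y]⟩

lemma ae_diff (h : DirLip H L) (hn : 3 ≤ n) :
    ∀ᵐ x : EuclideanSpace ℝ (Fin n), DifferentiableAt ℝ H x := by
  have : Nonempty (Fin n) := ⟨⟨0, by omega⟩⟩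
  have h1 : ∀ k : ℕ, ∀ᵐ x : EuclideanSpace ℝ (Fin n), ((k : ℝ) + 1)⁻¹ ≤ ‖x‖ →
      DifferentiableWithinAt ℝ H {x | ((k : ℝ) + 1)⁻¹ ≤ ‖x‖} x := fun k =>
    (h.lipOn (ρ := ((k : ℝ) + 1)⁻¹) (by positivity)).ae_differentiableWithinAt_of_mem
  rw [← ae_all_iff] at h1
  have h2 : ∀ᵐ x : EuclideanSpace ℝ (Fin n), x ≠ 0 := Measure.ae_ne _ _
  filter_upwards [h1, h2] with x hx hx0
  have h0 : 0 < ‖x‖ := norm_pos_iff.2 hx0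
  obtain ⟨k, hk⟩ := exists_nat_one_div_lt h0
  rw [one_div] at hk
  exact (hx k hk.le).differentiableAt (nhds_mem hk)

lemma fderiv_le (h : DirLip H L) {x : EuclideanSpace ℝ (Fin n)} (hx : x ≠ 0) :
    ‖fderiv ℝ H x‖ ≤ L / ‖x‖ := by
  have h0 : 0 < ‖x‖ := norm_pos_iff.2 hx
  have key : ∀ ρ, 0 < ρ → ρ < ‖x‖ → ‖fderiv ℝ H x‖ * ρ ≤ L := by
    intro ρ h1 h2
    have := norm_fderiv_le_of_lipschitzOn ℝ (nhds_mem h2) (h.lipOn h1)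
    rwa [Real.coe_toNNReal _ (div_nonneg h.1 h1.le), le_div_iff₀ h1] at this
  rw [le_div_iff₀ h0]
  by_contra! hc
  have hpos : 0 < ‖fderiv ℝ H x‖ := by
    by_contra! h3
    have : ‖fderiv ℝ H x‖ = 0 := le_antisymm h3 (norm_nonneg _)
    rw [this, zero_mul] at hc
    linarith [h.1]
  have h4 : L / ‖fderiv ℝ H x‖ < ‖x‖ := by
    rw [div_lt_iff₀ hpos]; linarith
  obtain ⟨ρ, h5, h6⟩ := exists_between h4
  have h7 : 0 < ρ := lt_of_le_of_lt (div_nonneg h.1 hpos.le) h5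
  have := key ρ h7 h6
  rw [div_lt_iff₀ hpos] at h5
  linarith

lemma smul_eq (h : DirLip H L) {x : EuclideanSpace ℝ (Fin n)} (hx : x ≠ 0) {t : ℝ} (ht : 0 < t) :
    H (t • x) = H x := by
  have := h.2 (t • x) x (by simp [hx, ht.ne']) hx
  rw [nrm_smul ht, sub_self, norm_zero, mul_zero] at this
  exact sub_eq_zero.1 (abs_nonpos_iff.1 this)

lemma fderiv_self (h : DirLip H L) {x : EuclideanSpace ℝ (Fin n)} (hx : x ≠ 0) :
    fderiv ℝ H x x = 0 := by
  by_cases hd : DifferentiableAt ℝ H x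
  · have h1 : HasDerivAt (fun t : ℝ => H (t • x)) (fderiv ℝ H x x) 1 := by
      have h2 : HasDerivAt (fun t : ℝ => t • x) x 1 := by
        simpa using (hasDerivAt_id (1:ℝ)).smul_const x
      have h3 : HasFDerivAt H (fderiv ℝ H x) ((1:ℝ) • x) := by
        rw [one_smul]; exact hd.hasFDerivAt
      exact h3.comp_hasDerivAt (1:ℝ) h2
    have h4 : HasDerivAt (fun t : ℝ => H (t • x)) 0 1 := by
      refine (hasDerivAt_const (1:ℝ) (H x)).congr_of_eventuallyEq ?_
      filter_upwards [lt_mem_nhds (zero_lt_one' ℝ)] with t ht using h.smul_eq hx ht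
    exact h1.unique h4
  · simp [fderiv_zero_of_not_differentiableAt hd]

lemma ftc (h : DirLip H L) {X Y : EuclideanSpace ℝ (Fin n)}
    (h0 : ∀ s : ℝ, cos s • X + sin s • Y ≠ 0)
    (hd : ∀ᵐ s : ℝ, DifferentiableAt ℝ H (cos s • X + sin s • Y)) :
    ∫ s in (0:ℝ)..(π/2), fderiv ℝ H (cos s • X + sin s • Y) (-sin s • X + cos s • Y)
      = H Y - H X := by
  set c : ℝ → EuclideanSpace ℝ (Fin n) := fun s => cos s • X + sin s • Y with hc
  have hcd : ∀ s, HasDerivAt c (-sin s • X + cos s • Y) s := fun s =>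
    ((hasDerivAt_cos s).smul_const X).add ((hasDerivAt_sin s).smul_const Y)
  have hcc : Continuous c := by fun_prop
  obtain ⟨s0, -, hs0⟩ := (isCompact_uIcc (a := (0:ℝ)) (b := π/2)).exists_isMinOn
    Set.nonempty_uIcc (f := fun s => ‖c s‖) (by fun_prop)
  have hρ : 0 < ‖c s0‖ := norm_pos_iff.2 (h0 s0)
  have hclip : LipschitzWith (‖X‖ + ‖Y‖).toNNReal c := by
    apply lipschitzWith_of_nnnorm_deriv_le (fun s => (hcd s).differentiableAt)
    intro s
    rw [(hcd s).deriv, ← NNReal.coe_le_coe, Real.coe_toNNReal _ (by positivity), coe_nnnorm]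
    refine (norm_add_le _ _).trans ?_
    rw [norm_smul, norm_smul]
    have h1 : ‖-sin s‖ ≤ 1 := by rw [norm_neg, Real.norm_eq_abs]; exact abs_sin_le_one s
    have h2 : ‖cos s‖ ≤ 1 := by rw [Real.norm_eq_abs]; exact abs_cos_le_one s
    gcongr
    · exact mul_le_of_le_one_left (norm_nonneg _) h1
    · exact mul_le_of_le_one_left (norm_nonneg _) h2
  have hl : LipschitzOnWith _ (H ∘ c) (Set.uIcc 0 (π/2)) :=
    (h.lipOn hρ).comp (hclip.lipschitzOnWith (s := Set.uIcc 0 (π/2))) (fun s hs => hs0 hs)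
  have := hl.absolutelyContinuousOnInterval.integral_deriv_eq_sub
  have e1 : (H ∘ c) (π/2) = H Y := by simp [hc]
  have e2 : (H ∘ c) 0 = H X := by simp [hc]
  rw [e1, e2] at this
  rw [← this]
  apply intervalIntegral.integral_congr_ae
  filter_upwards [hd] with s hs _
  exact (hs.hasFDerivAt.comp_hasDerivAt s (hcd s)).deriv.symm

end DirLip

lemma mp_integral {α β : Type*} [MeasurableSpace α] [MeasurableSpace β] {μ : Measure α}
    {ν : Measure β} {T : α → β} (hT : MeasurePreserving T μ ν) {g : β → ℝ} (hg : Measurable g) :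
    ∫ x, g (T x) ∂μ = ∫ y, g y ∂ν := by
  rw [← hT.map_eq, integral_map hT.measurable.aemeasurable hg.aestronglyMeasurable]

lemma meas_fd {n : ℕ} (H : EuclideanSpace ℝ (Fin n) → ℝ) :
    Measurable (fun p : EuclideanSpace ℝ (Fin n) × EuclideanSpace ℝ (Fin n) =>
      fderiv ℝ H p.1 p.2) := by
  have e : (fun p : EuclideanSpace ℝ (Fin n) × EuclideanSpace ℝ (Fin n) =>
      fderiv ℝ H p.1 p.2) = fun p => ∑ i, p.2 i * fderiv ℝ H p.1 (EuclideanSpace.single i 1) := by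
    ext p
    conv_lhs => rw [← (EuclideanSpace.basisFun (Fin n) ℝ).sum_repr p.2]
    simp [map_sum]
  rw [e]
  refine Finset.measurable_sum _ fun i _ => ?_
  refine Measurable.mul (by fun_prop) ?_
  exact (measurable_fderiv_apply_const ℝ H _).comp measurable_fst

lemma gauss_ae_ne {n : ℕ} (hn : 3 ≤ n) : ∀ᵐ x ∂(stdGaussian n), x ≠ 0 := by
  have : Nonempty (Fin n) := ⟨⟨0, by omega⟩⟩
  exact (gauss_ac n).ae_le (Measure.ae_ne _ _)

lemma gauss_indep {n : ℕ} (hn : 3 ≤ n) : ∀ᵐ p ∂((stdGaussian n).prod (stdGaussian n)),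
    ∀ s : ℝ, cos s • p.1 + sin s • p.2 ≠ 0 := by
  have key : ∀ᵐ p ∂((stdGaussian n).prod (stdGaussian n)),
      ‖p.1‖ ^ 2 * ‖p.2‖ ^ 2 ≠ (inner ℝ p.1 p.2) ^ 2 := by
    rw [Measure.ae_prod_iff_ae_ae]
    · filter_upwards [gauss_ae_ne hn] with X hX
      have hs : volume ((ℝ ∙ X : Submodule ℝ (EuclideanSpace ℝ (Fin n))) :
          Set (EuclideanSpace ℝ (Fin n))) = 0 := by
        apply Measure.addHaar_submodule
        intro h
        have h1 := finrank_span_singleton (K := ℝ) hX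
        rw [h, finrank_top, finrank_euclideanSpace, Fintype.card_fin] at h1
        omega
      have hs2 := (gauss_ac n) hs
      rw [← compl_mem_ae_iff] at hs2
      filter_upwards [hs2] with Y hY heq
      apply hY
      have hx : 0 < ‖X‖ ^ 2 := by have := norm_pos_iff.2 hX; positivity
      have : ‖Y - (inner ℝ X Y / ‖X‖ ^ 2) • X‖ ^ 2 = 0 := by
        rw [norm_sub_sq_real, norm_smul, real_inner_smul_right, real_inner_comm X Y, mul_pow,
          Real.norm_eq_abs, sq_abs]
        field_simp
        linarith
      have h2 : Y - (inner ℝ X Y / ‖X‖ ^ 2) • X = 0 := by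
        rwa [sq_eq_zero_iff, norm_eq_zero] at this
      rw [sub_eq_zero] at h2
      exact Submodule.mem_span_singleton.2 ⟨_, h2.symm⟩
    · apply MeasurableSet.compl
      exact measurableSet_eq_fun (by fun_prop) (by fun_prop)
  filter_upwards [key] with p hp s hs
  apply hp
  have h1 : inner ℝ (cos s • p.1 + sin s • p.2) p.1 = (0:ℝ) := by rw [hs, inner_zero_left]
  have h2 : inner ℝ (cos s • p.1 + sin s • p.2) p.2 = (0:ℝ) := by rw [hs, inner_zero_left]
  rw [inner_add_left, real_inner_smul_left, real_inner_smul_left, real_inner_self_eq_norm_sq,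
    real_inner_comm] at h1 h2
  rw [real_inner_comm p.1 p.2] at h2
  have h3 := Real.sin_sq_add_cos_sq s
  set a := ‖p.1‖ ^ 2
  set b := ‖p.2‖ ^ 2
  set i := (inner ℝ p.1 p.2 : ℝ)
  linear_combination (cos s * b - sin s * i) * h1 + (sin s * a - cos s * i) * h2 -
    (a * b - i ^ 2) * h3

/-- The pathwise rotation. -/
noncomputable def rotn {n : ℕ} (s : ℝ)
    (p : EuclideanSpace ℝ (Fin n) × EuclideanSpace ℝ (Fin n)) :
    EuclideanSpace ℝ (Fin n) × EuclideanSpace ℝ (Fin n) :=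
  (cos s • p.1 + sin s • p.2, -sin s • p.1 + cos s • p.2)

lemma rotn_meas (n : ℕ) : Measurable (Function.uncurry (rotn (n := n))) := by
  unfold rotn Function.uncurry
  fun_prop

lemma cov_int {n : ℕ} (hn : 3 ≤ n) {F H : EuclideanSpace ℝ (Fin n) → ℝ} {B L : ℝ}
    (hF : Measurable F) (hFB : ∀ x, |F x| ≤ B) (h : DirLip H L)
    (I : Measure ℝ) [IsFiniteMeasure I] :
    Integrable (fun q : ℝ × (EuclideanSpace ℝ (Fin n) × EuclideanSpace ℝ (Fin n)) =>
      F (cos q.1 • q.2.1 - sin q.1 • q.2.2) * fderiv ℝ H q.2.1 q.2.2)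
      (I.prod ((stdGaussian n).prod (stdGaussian n))) := by
  have k : Integrable (fun p : EuclideanSpace ℝ (Fin n) × EuclideanSpace ℝ (Fin n) =>
    ‖p.1‖⁻¹ * ‖p.2‖) ((stdGaussian n).prod (stdGaussian n)) :=
    (gauss_inv_norm_int hn).mul_prod (gauss_norm_int n)
  have k2 := (k.comp_snd I).const_mul (B * L)
  refine k2.mono' ?_ ?_
  · apply Measurable.aestronglyMeasurable
    refine (hF.comp (by fun_prop)).mul ((meas_fd H).comp measurable_snd)
  · have h1 : ∀ᵐ p ∂((stdGaussian n).prod (stdGaussian n)), p.1 ≠ 0 :=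
      Measure.quasiMeasurePreserving_fst.ae (gauss_ae_ne hn)
    have h2 : ∀ᵐ q ∂(I.prod ((stdGaussian n).prod (stdGaussian n))), q.2.1 ≠ 0 :=
      Measure.quasiMeasurePreserving_snd.ae h1
    filter_upwards [h2] with q hq
    rw [norm_mul, mul_assoc]
    have hB : 0 ≤ B := (abs_nonneg _).trans (hFB 0)
    refine mul_le_mul (hFB _) ?_ (norm_nonneg _) hB
    refine (ContinuousLinearMap.le_opNorm _ _).trans ?_
    rw [← mul_assoc, ← div_eq_mul_inv]
    gcongr
    exact h.fderiv_le hq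

theorem cov_id {n : ℕ} (hn : 3 ≤ n) {F H : EuclideanSpace ℝ (Fin n) → ℝ} {B L : ℝ}
    (hF : Measurable F) (hFB : ∀ x, |F x| ≤ B) (h : DirLip H L) :
    ∫ x, F x * H x ∂(stdGaussian n) - (∫ x, F x ∂(stdGaussian n)) * ∫ x, H x ∂(stdGaussian n) =
    - ∫ s in (0:ℝ)..(π/2), ∫ p, F (cos s • p.1 - sin s • p.2) * fderiv ℝ H p.1 p.2
      ∂((stdGaussian n).prod (stdGaussian n)) := by
  set γ := stdGaussian n with hγ
  obtain ⟨B', hB'⟩ := h.bounded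
  have hH := h.measurable
  have iF : Integrable F γ := Integrable.of_bound hF.aestronglyMeasurable B
    (by filter_upwards with x using hFB x)
  have iFH : Integrable (fun x => F x * H x) γ :=
    iF.mul_bdd hH.aestronglyMeasurable (c := B') (by filter_upwards with x using hB' x)
  have iH : Integrable H γ := Integrable.of_bound hH.aestronglyMeasurable B'
    (by filter_upwards with x using hB' x)
  set I := (volume : Measure ℝ).restrict (Set.Ioc 0 (π/2)) with hI
  set Φ := fun q : ℝ × (EuclideanSpace ℝ (Fin n) × EuclideanSpace ℝ (Fin n)) =>
      F (cos q.1 • q.2.1 - sin q.1 • q.2.2) * fderiv ℝ H q.2.1 q.2.2 with hΦ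
  have hΦm : Measurable Φ :=
    (hF.comp (by fun_prop)).mul ((meas_fd H).comp measurable_snd)
  have iΦ : Integrable Φ (I.prod (γ.prod γ)) := cov_int hn hF hFB h I
  have hT : MeasurePreserving (fun q : ℝ × (EuclideanSpace ℝ (Fin n) × EuclideanSpace ℝ (Fin n)) =>
      (q.1, rotn q.1 q.2)) (I.prod (γ.prod γ)) (I.prod (γ.prod γ)) := by
    refine MeasurePreserving.skew_product (MeasurePreserving.id I) (rotn_meas n) ?_
    filter_upwards with s
    exact (gauss_rot s).map_eq
  have iG := hT.integrable_comp_of_integrable iΦ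
  have eG : ∀ q : ℝ × (EuclideanSpace ℝ (Fin n) × EuclideanSpace ℝ (Fin n)),
      Φ (q.1, rotn q.1 q.2) = F q.2.1 * fderiv ℝ H (rotn q.1 q.2).1 (rotn q.1 q.2).2 := by
    intro q
    simp only [hΦ, rotn]
    congr 2
    have h3 := Real.sin_sq_add_cos_sq q.1
    trans (sin q.1 ^ 2 + cos q.1 ^ 2) • q.2.1
    · module
    · rw [h3, one_smul]
  -- differentiability along almost every path
  have hdiff : ∀ᵐ p ∂(γ.prod γ), ∀ᵐ s : ℝ, DifferentiableAt ℝ H (cos s • p.1 + sin s • p.2) := by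
    have hD : MeasurableSet {x | DifferentiableAt ℝ H x} := measurableSet_of_differentiableAt ℝ H
    have h1 : ∀ᵐ x ∂γ, DifferentiableAt ℝ H x := (gauss_ac n).ae_le (h.ae_diff hn)
    have h2 : ∀ᵐ p ∂(γ.prod γ), DifferentiableAt ℝ H p.1 :=
      Measure.quasiMeasurePreserving_fst.ae h1
    have h3 : ∀ s : ℝ, ∀ᵐ p ∂(γ.prod γ), DifferentiableAt ℝ H (cos s • p.1 + sin s • p.2) :=
      fun s => (gauss_rot s).quasiMeasurePreserving.ae h2
    have h4 : ∀ᵐ s : ℝ, ∀ᵐ p ∂(γ.prod γ), DifferentiableAt ℝ H (cos s • p.1 + sin s • p.2) := by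
      filter_upwards with s using h3 s
    refine (Measure.ae_ae_comm ?_).1 h4
    have : Measurable (fun q : ℝ × (EuclideanSpace ℝ (Fin n) × EuclideanSpace ℝ (Fin n)) =>
      cos q.1 • q.2.1 + sin q.1 • q.2.2) := by fun_prop
    exact this hD
  have hpath : ∀ᵐ p ∂(γ.prod γ), F p.1 * (H p.1 - H p.2) = - ∫ s, Φ (s, rotn s p) ∂I := by
    filter_upwards [hdiff, gauss_indep hn] with p hp1 hp2
    have := h.ftc hp2 hp1
    rw [intervalIntegral.integral_of_le (by positivity)] at this
    have e : ∀ s, Φ (s, rotn s p) = F p.1 * fderiv ℝ H (rotn s p).1 (rotn s p).2 :=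
      fun s => eG (s, p)
    simp_rw [e]
    rw [integral_const_mul]
    simp only [rotn]
    rw [this]
    ring
  have step1 : ∫ x, F x * H x ∂γ - (∫ x, F x ∂γ) * ∫ x, H x ∂γ =
      ∫ p, F p.1 * (H p.1 - H p.2) ∂(γ.prod γ) := by
    simp_rw [mul_sub]
    rw [integral_sub (iFH.comp_fst γ) (iF.mul_prod iH), integral_prod_mul]
    congr 1
    rw [integral_fun_fst (fun x => F x * H x)]
    simp
  rw [step1, integral_congr_ae hpath, integral_neg]
  congr 1
  rw [intervalIntegral.integral_of_le (by positivity)]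
  rw [← integral_integral_swap (f := fun s p => Φ (s, rotn s p)) iG]
  apply integral_congr_ae
  filter_upwards with s
  exact mp_integral (gauss_rot s) (g := fun p => Φ (s, p)) (hΦm.comp (by fun_prop))

/-- Projection to the orthogonal complement of `X`. -/
noncomputable def perp {n : ℕ} (X Y : EuclideanSpace ℝ (Fin n)) : EuclideanSpace ℝ (Fin n) :=
  Y - (inner ℝ X Y / ‖X‖ ^ 2) • X

lemma perp_inner {n : ℕ} {X : EuclideanSpace ℝ (Fin n)} (hX : X ≠ 0) (Y) :
    inner ℝ X (perp X Y) = (0:ℝ) := by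
  have : ‖X‖ ≠ 0 := norm_ne_zero_iff.2 hX
  rw [perp, inner_sub_right, real_inner_smul_right, real_inner_self_eq_norm_sq]
  field_simp
  ring

lemma measurable_nrm {n : ℕ} : Measurable (nrm (n := n)) := by
  unfold nrm
  fun_prop

lemma nrm_isom {n : ℕ} (R : EuclideanSpace ℝ (Fin n) ≃ₗᵢ[ℝ] EuclideanSpace ℝ (Fin n)) (x) :
    nrm (R x) = R (nrm x) := by
  simp [nrm]

lemma coord_dirLip {n : ℕ} (i : Fin n) : DirLip (fun x : EuclideanSpace ℝ (Fin n) => nrm x i) 1 := by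
  refine ⟨zero_le_one, fun x y _ _ => ?_⟩
  rw [one_mul]
  have := PiLp.norm_apply_le (nrm x - nrm y) i
  simpa using this

lemma hasDeriv_nrm {n : ℕ} {X : EuclideanSpace ℝ (Fin n)} (hX : X ≠ 0) (Y) :
    HasDerivAt (fun t : ℝ => nrm (X + t • Y)) (‖X‖⁻¹ • perp X Y) 0 := by
  have h0 : 0 < ‖X‖ := norm_pos_iff.2 hX
  have hc : HasDerivAt (fun t : ℝ => X + t • Y) Y 0 := by
    simpa using ((hasDerivAt_id (0:ℝ)).smul_const Y).const_add X
  have h1 := hc.norm_sq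
  have h2 := (h1.sqrt (by simp [hX])).inv (by simp [hX])
  simp only [zero_smul, add_zero, Real.sqrt_sq (norm_nonneg _)] at h2
  have h3 := h2.smul hc
  have e : (fun t : ℝ => nrm (X + t • Y)) =
      (fun t : ℝ => ‖X + t • Y‖)⁻¹ • (fun t : ℝ => X + t • Y) := by
    ext1 t; rfl
  have e2 : ‖X‖⁻¹ • perp X Y = (fun y : ℝ => ‖X + y • Y‖)⁻¹ 0 • Y +
      (-(2 * inner ℝ X Y / (2 * ‖X‖)) / ‖X‖ ^ 2) • (X + (0:ℝ) • Y) := by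
    simp only [Pi.inv_apply, zero_smul, add_zero]
    rw [perp, smul_sub, sub_eq_add_neg, smul_smul, ← neg_smul]
    congr 2
    field_simp
  rw [e, e2]
  exact h3

lemma fderiv_nrm {n : ℕ} {X : EuclideanSpace ℝ (Fin n)} (hX : X ≠ 0) (Y) (i : Fin n) :
    fderiv ℝ (fun x : EuclideanSpace ℝ (Fin n) => nrm x i) X Y = ‖X‖⁻¹ * perp X Y i := by
  have h0 : ‖X‖ ≠ 0 := norm_ne_zero_iff.2 hX
  have hd : DifferentiableAt ℝ (fun x : EuclideanSpace ℝ (Fin n) => nrm x i) X := by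
    have : DifferentiableAt ℝ (fun x : EuclideanSpace ℝ (Fin n) => ‖x‖⁻¹ * x i) X := by
      refine ((differentiableAt_id.norm ℝ hX).inv h0).mul ?_
      fun_prop
    exact this
  have hc : HasDerivAt (fun t : ℝ => X + t • Y) Y 0 := by
    simpa using ((hasDerivAt_id (0:ℝ)).smul_const Y).const_add X
  have h1 : HasDerivAt (fun t : ℝ => nrm (X + t • Y) i)
      (fderiv ℝ (fun x : EuclideanSpace ℝ (Fin n) => nrm x i) X Y) 0 := by
    have h3 : HasFDerivAt (fun x : EuclideanSpace ℝ (Fin n) => nrm x i)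
      (fderiv ℝ (fun x : EuclideanSpace ℝ (Fin n) => nrm x i) X) (X + (0:ℝ) • Y) := by
      rw [zero_smul, add_zero]; exact hd.hasFDerivAt
    exact h3.comp_hasDerivAt (0:ℝ) hc
  have h2 := (hasDeriv_nrm hX Y)
  have h4 := ((EuclideanSpace.proj i : EuclideanSpace ℝ (Fin n) →L[ℝ] ℝ).hasFDerivAt
    (x := nrm (X + (0:ℝ) • Y))).comp_hasDerivAt (0:ℝ) h2
  have := h1.unique h4
  rw [this]
  simp

/-- `Z = cos s X - sin s Y`. -/
noncomputable def zz {n : ℕ} (s : ℝ) (X Y : EuclideanSpace ℝ (Fin n)) : EuclideanSpace ℝ (Fin n) :=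
  cos s • X - sin s • Y

lemma zz_isom {n : ℕ} (R : EuclideanSpace ℝ (Fin n) ≃ₗᵢ[ℝ] EuclideanSpace ℝ (Fin n)) (s X Y) :
    zz s (R X) (R Y) = R (zz s X Y) := by
  simp [zz]

lemma zz_meas {n : ℕ} (s : ℝ) (X : EuclideanSpace ℝ (Fin n)) : Measurable (zz s X) := by
  unfold zz; fun_prop

/-- The directional integral. -/
noncomputable def JJ {n : ℕ} (s : ℝ) (X w : EuclideanSpace ℝ (Fin n)) : ℝ :=
  ∫ Y, inner ℝ (nrm (zz s X Y)) w * inner ℝ w Y ∂(stdGaussian n)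

/-- The radial integral. -/
noncomputable def QQ {n : ℕ} (s : ℝ) (X : EuclideanSpace ℝ (Fin n)) : ℝ :=
  ∫ Y, inner ℝ (nrm (zz s X Y)) (perp X Y) ∂(stdGaussian n)

lemma inner_int {n : ℕ} (w : EuclideanSpace ℝ (Fin n)) :
    Integrable (fun Y => (inner ℝ w Y : ℝ)) (stdGaussian n) :=
  (gauss_norm_int n).const_mul ‖w‖ |>.mono' (by fun_prop)
    (by filter_upwards with Y using norm_inner_le_norm w Y)

lemma bdd_inner_int {n : ℕ} {G : EuclideanSpace ℝ (Fin n) → ℝ} (hG : Measurable G) {B : ℝ}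
    (hB : ∀ x, |G x| ≤ B) (s : ℝ) (X w : EuclideanSpace ℝ (Fin n)) :
    Integrable (fun Y => G (zz s X Y) * inner ℝ w Y) (stdGaussian n) :=
  (inner_int w).bdd_mul (hG.comp (zz_meas s X)).aestronglyMeasurable (c := B)
    (by filter_upwards with Y using hB _)

lemma refl_apply {n : ℕ} {w : EuclideanSpace ℝ (Fin n)} (hw : ‖w‖ = 1) (x) :
    (ℝ ∙ w)ᗮ.reflection x = x - (2 * inner ℝ w x) • w := by
  rw [Submodule.reflection_orthogonal_apply, Submodule.reflection_singleton_apply, hw]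
  simp only [RCLike.ofReal_one, one_pow, div_one]
  module

/-- The reflection inequality. -/
lemma claim1 {n : ℕ} {F : EuclideanSpace ℝ (Fin n) → ℝ} (h : DirLip F 1) {s : ℝ} (hs : 0 ≤ sin s)
    {X w : EuclideanSpace ℝ (Fin n)} (hw : ‖w‖ = 1) (hX : inner ℝ w X = (0:ℝ)) :
    - ∫ Y, F (zz s X Y) * inner ℝ w Y ∂(stdGaussian n) ≤ - JJ s X w := by
  set R := (ℝ ∙ w)ᗮ.reflection
  have hR : ∀ x, R x = x - (2 * inner ℝ w x) • w := refl_apply hw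
  have hRX : R X = X := by rw [hR, hX]; simp
  have hRw : ∀ Y, inner ℝ w (R Y) = -(inner ℝ w Y : ℝ) := by
    intro Y
    rw [hR, inner_sub_right, real_inner_smul_right, real_inner_self_eq_norm_sq, hw]
    ring
  have key : ∀ {G : EuclideanSpace ℝ (Fin n) → ℝ}, Measurable G → ∀ {B : ℝ}, (∀ x, |G x| ≤ B) →
      ∫ Y, G (zz s X Y) * inner ℝ w Y ∂(stdGaussian n) =
      ∫ Y, (1/2) * ((G (zz s X Y) - G (R (zz s X Y))) * inner ℝ w Y) ∂(stdGaussian n) ∧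
      Integrable (fun Y => (1/2) * ((G (zz s X Y) - G (R (zz s X Y))) * inner ℝ w Y))
        (stdGaussian n) := by
    intro G hG B hB
    have i1 := bdd_inner_int hG hB s X w
    have i2 := bdd_inner_int (G := fun x => G (R x)) (hG.comp R.continuous.measurable)
      (fun x => hB (R x)) s X w
    have e1 : ∫ Y, G (zz s X Y) * inner ℝ w Y ∂(stdGaussian n) =
        - ∫ Y, G (R (zz s X Y)) * inner ℝ w Y ∂(stdGaussian n) := by
      have := mp_integral (gauss_isom R) (g := fun Y => G (zz s X Y) * inner ℝ w Y)
        ((hG.comp (zz_meas s X)).mul (by fun_prop))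
      rw [← this, ← integral_neg]
      congr 1 with Y
      rw [hRw, ← zz_isom, hRX]
      ring
    have i3 := (i1.sub i2).const_mul (1/2)
    refine ⟨?_, i3.congr (by filter_upwards with Y; simp only [Pi.sub_apply]; ring)⟩
    simp_rw [sub_mul]
    rw [integral_const_mul, integral_sub i1 i2]
    linarith
  obtain ⟨B, hB⟩ := h.bounded
  obtain ⟨a1, a2⟩ := key h.measurable hB
  obtain ⟨b1, b2⟩ := key (G := fun x => inner ℝ (nrm x) w)
    (measurable_nrm.inner measurable_const) (B := 1)
    (fun x => (abs_real_inner_le_norm _ _).trans (by rw [hw, mul_one]; exact nrm_norm_le x))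
  rw [JJ, a1, b1, ← integral_neg, ← integral_neg]
  refine integral_mono a2.neg b2.neg fun Y => ?_
  simp only [Pi.neg_apply]
  set Z := zz s X Y with hZ
  set i := (inner ℝ w Y : ℝ) with hi
  have hwZ : (inner ℝ w Z : ℝ) = - (sin s * i) := by
    rw [hZ, zz, inner_sub_right, real_inner_smul_right, real_inner_smul_right, hX]; ring
  have hd : nrm Z - nrm (R Z) = (-(‖Z‖⁻¹ * (2 * (sin s * i)))) • w := by
    rw [nrm, nrm, R.norm_map, ← smul_sub, hR, hwZ, sub_sub_cancel, smul_smul]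
    congr 1; ring
  have h1 : (inner ℝ (nrm Z) w : ℝ) - inner ℝ (nrm (R Z)) w = -(‖Z‖⁻¹ * (2 * (sin s * i))) := by
    rw [← inner_sub_left, hd, real_inner_smul_left, real_inner_self_eq_norm_sq, hw]; ring
  rw [h1]
  have h2 : |F Z - F (R Z)| ≤ ‖Z‖⁻¹ * (2 * (sin s * |i|)) := by
    by_cases hZ0 : Z = 0
    · simp [hZ0]
    · have := h.2 Z (R Z) hZ0 (by simpa using hZ0)
      rw [hd, norm_smul, hw, one_mul, mul_one, norm_neg, Real.norm_eq_abs, abs_mul, abs_mul, abs_mul,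
        abs_of_nonneg hs, abs_of_nonneg (inv_nonneg.2 (norm_nonneg Z)), abs_two] at this
      exact this
  have h3 : -((F Z - F (R Z)) * i) ≤ |F Z - F (R Z)| * |i| := by
    rw [← abs_mul]; exact neg_le_abs _
  have h4 := mul_le_mul_of_nonneg_right h2 (abs_nonneg i)
  have h5 : ‖Z‖⁻¹ * (2 * (sin s * |i|)) * |i| = ‖Z‖⁻¹ * (2 * (sin s * i)) * i := by
    have := abs_mul_abs_self i
    linear_combination (‖Z‖⁻¹ * 2 * sin s) * this
  linarith

lemma JJ_eq {n : ℕ} (s : ℝ) {X w w' : EuclideanSpace ℝ (Fin n)} (hw : ‖w‖ = 1) (hw' : ‖w'‖ = 1)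
    (hX : inner ℝ w X = (0:ℝ)) (hX' : inner ℝ w' X = (0:ℝ)) : JJ s X w = JJ s X w' := by
  set R := (ℝ ∙ (w - w'))ᗮ.reflection
  have hRw : R w = w' := Submodule.reflection_sub (hw.trans hw'.symm)
  have hRX : R X = X := by
    apply Submodule.reflection_mem_subspace_eq_self
    rw [Submodule.mem_orthogonal_singleton_iff_inner_right, inner_sub_left, hX, hX', sub_zero]
  have m : Measurable (fun Y => inner ℝ (nrm (zz s X Y)) w' * (inner ℝ w' Y : ℝ)) :=
    ((measurable_nrm.comp (zz_meas s X)).inner measurable_const).mul (by fun_prop)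
  have := mp_integral (gauss_isom R) m
  rw [JJ, JJ, ← this]
  congr 1 with Y
  conv_rhs => rw [← hRX, zz_isom, nrm_isom, ← hRw]
  rw [LinearIsometryEquiv.inner_map_map, LinearIsometryEquiv.inner_map_map]

lemma claim2 {n : ℕ} (hn : 3 ≤ n) (s : ℝ) {X w : EuclideanSpace ℝ (Fin n)} (h0 : X ≠ 0)
    (hw : ‖w‖ = 1) (hX : inner ℝ w X = (0:ℝ)) : QQ s X = ((n:ℝ) - 1) * JJ s X w := by
  set K := (ℝ ∙ X)ᗮ
  have hK : Module.finrank ℝ K = n - 1 := by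
    have h1 : Module.finrank ℝ (ℝ ∙ X) + Module.finrank ℝ K =
      Module.finrank ℝ (EuclideanSpace ℝ (Fin n)) := Submodule.finrank_add_finrank_orthogonal _
    rw [finrank_span_singleton h0, finrank_euclideanSpace, Fintype.card_fin] at h1
    omega
  set b := stdOrthonormalBasis ℝ K
  have hb1 : ∀ i, ‖(b i : EuclideanSpace ℝ (Fin n))‖ = 1 := fun i => by
    have := b.norm_eq_one i
    exact this
  have hb2 : ∀ i, inner ℝ (b i : EuclideanSpace ℝ (Fin n)) X = (0:ℝ) := fun i =>
    Submodule.mem_orthogonal_singleton_iff_inner_left.1 (b i).2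
  have hsum : ∀ Y, perp X Y = ∑ i, (inner ℝ (b i : EuclideanSpace ℝ (Fin n)) Y : ℝ) •
      (b i : EuclideanSpace ℝ (Fin n)) := by
    intro Y
    have hm : perp X Y ∈ K := Submodule.mem_orthogonal_singleton_iff_inner_right.2
      (perp_inner h0 Y)
    have h1 := b.sum_repr' ⟨perp X Y, hm⟩
    have h2 := congrArg (fun v : K => (v : EuclideanSpace ℝ (Fin n))) h1
    simp only [Submodule.coe_sum, Submodule.coe_smul, Submodule.coe_inner] at h2
    rw [← h2]
    refine Finset.sum_congr rfl fun i _ => ?_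
    congr 1
    rw [perp, inner_sub_right, real_inner_smul_right, hb2]
    ring
  have : QQ s X = ∑ i, JJ s X (b i) := by
    rw [QQ]
    simp only [JJ]
    rw [← integral_finsetSum]
    · congr 1 with Y
      rw [hsum, inner_sum]
      refine Finset.sum_congr rfl fun i _ => ?_
      rw [real_inner_smul_right]; ring
    · intro i _
      exact bdd_inner_int (G := fun x => inner ℝ (nrm x) (b i : EuclideanSpace ℝ (Fin n)))
        (measurable_nrm.inner measurable_const) (B := 1)
        (fun x => (abs_real_inner_le_norm _ _).trans
          (by rw [hb1, mul_one]; exact nrm_norm_le x)) s X _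
  rw [this, Finset.sum_congr rfl fun i _ => JJ_eq s (hb1 i) hw (hb2 i) hX]
  rw [Finset.sum_const, Finset.card_univ, Fintype.card_fin, hK, nsmul_eq_mul,
    Nat.cast_sub (by omega)]
  simp

lemma QQ_radial {n : ℕ} (s : ℝ) {X X' : EuclideanSpace ℝ (Fin n)} (h : ‖X‖ = ‖X'‖) :
    QQ s X = QQ s X' := by
  set R := (ℝ ∙ (X - X'))ᗮ.reflection
  have hRX : R X = X' := Submodule.reflection_sub h
  have m : Measurable (fun Y => (inner ℝ (nrm (zz s X' Y)) (perp X' Y) : ℝ)) :=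
    (measurable_nrm.comp (zz_meas s X')).inner (by unfold perp; fun_prop)
  have := mp_integral (gauss_isom R) m
  rw [QQ, QQ, ← this]
  congr 1 with Y
  rw [← hRX, zz_isom, nrm_isom]
  have : perp (R X) (R Y) = R (perp X Y) := by simp [perp]
  rw [this, LinearIsometryEquiv.inner_map_map]

lemma exists_orth {n : ℕ} (hn : 3 ≤ n) {X : EuclideanSpace ℝ (Fin n)} (h0 : X ≠ 0) :
    ∃ w : EuclideanSpace ℝ (Fin n), ‖w‖ = 1 ∧ inner ℝ w X = (0:ℝ) := by
  have h1 : Module.finrank ℝ (ℝ ∙ X) + Module.finrank ℝ ((ℝ ∙ X)ᗮ : Submodule ℝ _) =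
      Module.finrank ℝ (EuclideanSpace ℝ (Fin n)) := Submodule.finrank_add_finrank_orthogonal _
  rw [finrank_span_singleton h0, finrank_euclideanSpace, Fintype.card_fin] at h1
  obtain ⟨v, hv⟩ := Module.finrank_pos_iff_exists_ne_zero.1
    (show 0 < Module.finrank ℝ ((ℝ ∙ X)ᗮ : Submodule ℝ _) by omega)
  have hv' : (v : EuclideanSpace ℝ (Fin n)) ≠ 0 := by simpa using hv
  refine ⟨‖(v : EuclideanSpace ℝ (Fin n))‖⁻¹ • (v : EuclideanSpace ℝ (Fin n)),
    norm_smul_inv_norm hv', ?_⟩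
  rw [real_inner_smul_left, Submodule.mem_orthogonal_singleton_iff_inner_left.1 v.2, mul_zero]

lemma QQ_nonpos {n : ℕ} (hn : 3 ≤ n) {s : ℝ} (hs : 0 ≤ sin s) {X : EuclideanSpace ℝ (Fin n)}
    (h0 : X ≠ 0) : QQ s X ≤ 0 := by
  obtain ⟨w, hw, hX⟩ := exists_orth hn h0
  have h1 := claim1 (F := fun _ : EuclideanSpace ℝ (Fin n) => 0)
    ⟨zero_le_one, fun x y _ _ => by simp⟩ hs hw hX
  simp only [zero_mul, integral_zero, neg_zero] at h1
  rw [claim2 hn s h0 hw hX]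
  have : (3:ℝ) ≤ n := by exact_mod_cast hn
  nlinarith

lemma lemA {n : ℕ} (hn : 3 ≤ n) {F : EuclideanSpace ℝ (Fin n) → ℝ} (h : DirLip F 1) {s : ℝ}
    (hs : 0 ≤ sin s) {X g : EuclideanSpace ℝ (Fin n)} (h0 : X ≠ 0) (hX : inner ℝ g X = (0:ℝ))
    {d : ℝ} (hd : ‖g‖ ≤ d) :
    - ∫ Y, F (zz s X Y) * inner ℝ g Y ∂(stdGaussian n) ≤ d * (- QQ s X) / ((n:ℝ) - 1) := by
  have hn' : (0:ℝ) < (n:ℝ) - 1 := by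
    have : (3:ℝ) ≤ n := by exact_mod_cast hn
    linarith
  have hQ := QQ_nonpos hn hs h0
  have hmono : ‖g‖ * (- QQ s X) / ((n:ℝ) - 1) ≤ d * (- QQ s X) / ((n:ℝ) - 1) := by
    gcongr; linarith
  refine le_trans ?_ hmono
  by_cases hg : g = 0
  · simp [hg]
  have hg' : ‖g‖ ≠ 0 := norm_ne_zero_iff.2 hg
  have hw : ‖‖g‖⁻¹ • g‖ = 1 := norm_smul_inv_norm hg
  have hwX : inner ℝ (‖g‖⁻¹ • g) X = (0:ℝ) := by rw [real_inner_smul_left, hX, mul_zero]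
  have h1 := claim1 h hs hw hwX
  rw [claim2 hn s h0 hw hwX]
  have e : ∫ Y, F (zz s X Y) * inner ℝ g Y ∂(stdGaussian n) =
      ‖g‖ * ∫ Y, F (zz s X Y) * inner ℝ (‖g‖⁻¹ • g) Y ∂(stdGaussian n) := by
    rw [← integral_const_mul]
    congr 1 with Y
    rw [real_inner_smul_left]
    field_simp
  rw [e]
  have h2 := mul_le_mul_of_nonneg_left h1 (norm_nonneg g)
  have e2 : ‖g‖ * -(((n:ℝ) - 1) * JJ s X (‖g‖⁻¹ • g)) / ((n:ℝ) - 1) =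
    ‖g‖ * - JJ s X (‖g‖⁻¹ • g) := by field_simp
  rw [e2]
  linarith

lemma perp_le {n : ℕ} (X Y : EuclideanSpace ℝ (Fin n)) : ‖perp X Y‖ ≤ 2 * ‖Y‖ := by
  by_cases h : X = 0
  · simp [perp, h]; linarith [norm_nonneg Y]
  have h0 : 0 < ‖X‖ := norm_pos_iff.2 h
  have h1 : ‖(inner ℝ X Y / ‖X‖ ^ 2) • X‖ ≤ ‖Y‖ := by
    rw [norm_smul, norm_div, norm_pow, norm_norm]
    have := norm_inner_le_norm (𝕜 := ℝ) X Y
    calc ‖(inner ℝ X Y : ℝ)‖ / ‖X‖ ^ 2 * ‖X‖ ≤ (‖X‖ * ‖Y‖) / ‖X‖ ^ 2 * ‖X‖ := by gcongr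
      _ = ‖Y‖ := by field_simp
  have := norm_sub_le Y ((inner ℝ X Y / ‖X‖ ^ 2) • X)
  rw [perp]; linarith

lemma QQ_bdd {n : ℕ} (s : ℝ) (X : EuclideanSpace ℝ (Fin n)) :
    ‖QQ s X‖ ≤ ∫ Y, 2 * ‖Y‖ ∂(stdGaussian n) := by
  rw [QQ]
  refine norm_integral_le_of_norm_le ((gauss_norm_int n).const_mul 2) ?_
  filter_upwards with Y
  refine (norm_inner_le_norm _ _).trans ?_
  have := mul_le_mul (nrm_norm_le (zz s X Y)) (perp_le X Y) (norm_nonneg _) zero_le_one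
  simpa using this

lemma QQ_meas {n : ℕ} (s : ℝ) : Measurable (fun X : EuclideanSpace ℝ (Fin n) => QQ s X) := by
  have m : Measurable (fun p : EuclideanSpace ℝ (Fin n) × EuclideanSpace ℝ (Fin n) =>
      (inner ℝ (nrm (zz s p.1 p.2)) (perp p.1 p.2) : ℝ)) := by
    refine (measurable_nrm.comp ?_).inner ?_
    · unfold zz; fun_prop
    · unfold perp; fun_prop
  exact (m.stronglyMeasurable.integral_prod_right (ν := stdGaussian n)).measurable

lemma QQ_int {n : ℕ} (hn : 3 ≤ n) (s : ℝ) :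
    Integrable (fun X : EuclideanSpace ℝ (Fin n) => QQ s X * ‖X‖⁻¹) (stdGaussian n) :=
  (gauss_inv_norm_int hn).bdd_mul (QQ_meas s).aestronglyMeasurable
    (by filter_upwards with X using QQ_bdd s X)

lemma cov_int_s {n : ℕ} (hn : 3 ≤ n) {F H : EuclideanSpace ℝ (Fin n) → ℝ} {B L : ℝ}
    (hF : Measurable F) (hFB : ∀ x, |F x| ≤ B) (h : DirLip H L) (s : ℝ) :
    Integrable (fun p : (EuclideanSpace ℝ (Fin n) × EuclideanSpace ℝ (Fin n)) =>
      F (cos s • p.1 - sin s • p.2) * fderiv ℝ H p.1 p.2)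
      ((stdGaussian n).prod (stdGaussian n)) := by
  have h1 := (cov_int hn hF hFB h (Measure.dirac s)).prod_right_ae
  rw [ae_dirac_eq] at h1
  exact h1

lemma lemB {n : ℕ} (hn : 3 ≤ n) {F H D : EuclideanSpace ℝ (Fin n) → ℝ} {L C : ℝ}
    (hF : DirLip F 1) (hH : DirLip H L) (hD : Measurable D) (hDC : ∀ x, |D x| ≤ C)
    (hDH : ∀ᵐ X ∂(stdGaussian n), ‖fderiv ℝ H X‖ ≤ D (nrm X) * ‖X‖⁻¹) {s : ℝ} (hs : 0 ≤ sin s) :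
    - ∫ p, F (cos s • p.1 - sin s • p.2) * fderiv ℝ H p.1 p.2
      ∂((stdGaussian n).prod (stdGaussian n)) ≤
    (1 / ((n:ℝ) - 1)) * (∫ X, D (nrm X) ∂(stdGaussian n)) *
      (- ∫ X, QQ s X * ‖X‖⁻¹ ∂(stdGaussian n)) := by
  obtain ⟨B, hB⟩ := hF.bounded
  have hi := cov_int_s hn hF.measurable hB hH s
  rw [integral_prod _ hi]
  have hi2 := hi.integral_prod_left
  have hpol : ∫ X, D (nrm X) * (QQ s X * ‖X‖⁻¹) ∂(stdGaussian n) =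
      (∫ X, D (nrm X) ∂(stdGaussian n)) * ∫ X, QQ s X * ‖X‖⁻¹ ∂(stdGaussian n) := by
    set e : EuclideanSpace ℝ (Fin n) := EuclideanSpace.single ⟨0, by omega⟩ 1 with he
    have hr : ∀ X : EuclideanSpace ℝ (Fin n), QQ s X = QQ s (‖X‖ • e) := fun X =>
      QQ_radial s (by rw [norm_smul, norm_norm, he]; simp)
    have := gauss_polar hn D (fun t => QQ s (t • e) * t⁻¹)
    simp only [← hr] at this
    exact this
  have hi3 : Integrable (fun X => D (nrm X) * (QQ s X * ‖X‖⁻¹)) (stdGaussian n) :=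
    (QQ_int hn s).bdd_mul (c := C) (hD.comp measurable_nrm).aestronglyMeasurable
      (by filter_upwards with X using hDC _)
  have e3 : (1 / ((n:ℝ) - 1)) * (∫ X, D (nrm X) ∂(stdGaussian n)) *
      (- ∫ X, QQ s X * ‖X‖⁻¹ ∂(stdGaussian n)) =
      ∫ X, (-(1 / ((n:ℝ) - 1))) * (D (nrm X) * (QQ s X * ‖X‖⁻¹)) ∂(stdGaussian n) := by
    rw [integral_const_mul, hpol]; ring
  rw [e3, ← integral_neg]
  refine integral_mono_ae hi2.neg (hi3.const_mul _) ?_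
  filter_upwards [hDH, gauss_ae_ne hn] with X hX h0
  set g := (InnerProductSpace.toDual ℝ (EuclideanSpace ℝ (Fin n))).symm (fderiv ℝ H X) with hg
  have hgY : ∀ Y, fderiv ℝ H X Y = inner ℝ g Y := fun Y => by
    rw [hg, InnerProductSpace.toDual_symm_apply]
  have hgn : ‖g‖ ≤ D (nrm X) * ‖X‖⁻¹ := by
    rw [hg, LinearIsometryEquiv.norm_map]; exact hX
  have hgX : inner ℝ g X = (0:ℝ) := by
    rw [← hgY]; exact hH.fderiv_self h0
  have := lemA hn hF hs h0 hgX hgn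
  simp only [hgY, zz] at this ⊢
  refine this.trans (le_of_eq ?_)
  ring

lemma coord_sum {n : ℕ} (hn : 3 ≤ n) (s : ℝ) :
    ∑ i : Fin n, ∫ p, nrm (cos s • p.1 - sin s • p.2) i *
      fderiv ℝ (fun x : EuclideanSpace ℝ (Fin n) => nrm x i) p.1 p.2
      ∂((stdGaussian n).prod (stdGaussian n)) = ∫ X, QQ s X * ‖X‖⁻¹ ∂(stdGaussian n) := by
  have hi : ∀ i : Fin n, Integrable (fun p : (EuclideanSpace ℝ (Fin n) × EuclideanSpace ℝ (Fin n)) =>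
      nrm (cos s • p.1 - sin s • p.2) i *
      fderiv ℝ (fun x : EuclideanSpace ℝ (Fin n) => nrm x i) p.1 p.2)
      ((stdGaussian n).prod (stdGaussian n)) := fun i => by
    obtain ⟨B, hB⟩ := (coord_dirLip i).bounded
    exact cov_int_s hn (coord_dirLip i).measurable hB (coord_dirLip i) s
  rw [← integral_finsetSum _ (fun i _ => hi i), integral_prod _ (integrable_finsetSum _ fun i _ => hi i)]
  refine integral_congr_ae ?_
  filter_upwards [gauss_ae_ne hn] with X hX
  rw [QQ, ← integral_mul_const]
  congr 1 with Y
  simp only [fderiv_nrm hX]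
  rw [PiLp.inner_apply, Finset.sum_mul]
  refine Finset.sum_congr rfl fun i _ => ?_
  simp [zz]
  ring

lemma lemC {n : ℕ} (hn : 3 ≤ n) :
    IntervalIntegrable (fun s => ∫ X, QQ s X * ‖X‖⁻¹ ∂(stdGaussian n)) volume 0 (π/2) ∧
    (∫ s in (0:ℝ)..(π/2), - ∫ X, QQ s X * ‖X‖⁻¹ ∂(stdGaussian n)) ≤ 1 := by
  have hpi : (0:ℝ) ≤ π / 2 := by positivity
  have hii : ∀ i : Fin n, IntervalIntegrable (fun s => ∫ p, nrm (cos s • p.1 - sin s • p.2) i *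
      fderiv ℝ (fun x : EuclideanSpace ℝ (Fin n) => nrm x i) p.1 p.2
      ∂((stdGaussian n).prod (stdGaussian n))) volume 0 (π/2) := fun i => by
    obtain ⟨B, hB⟩ := (coord_dirLip i).bounded
    rw [intervalIntegrable_iff_integrableOn_Ioc_of_le hpi]
    exact (cov_int hn (coord_dirLip i).measurable hB (coord_dirLip i)
      (volume.restrict (Set.Ioc 0 (π/2)))).integral_prod_left
  have e1 : ∀ i : Fin n, - ∫ s in (0:ℝ)..(π/2), ∫ p, nrm (cos s • p.1 - sin s • p.2) i *
      fderiv ℝ (fun x : EuclideanSpace ℝ (Fin n) => nrm x i) p.1 p.2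
      ∂((stdGaussian n).prod (stdGaussian n)) ≤ ∫ x, nrm x i * nrm x i ∂(stdGaussian n) := fun i => by
    obtain ⟨B, hB⟩ := (coord_dirLip i).bounded
    have := cov_id hn (coord_dirLip i).measurable hB (coord_dirLip i)
    rw [← this]
    nlinarith [mul_self_nonneg (∫ x, nrm x i ∂(stdGaussian n))]
  constructor
  · simp_rw [← coord_sum hn]
    have := IntervalIntegrable.sum Finset.univ (fun i _ => hii i)
    refine this.congr ?_
    intro s _
    simp
  · rw [intervalIntegral.integral_neg]
    simp_rw [← coord_sum hn]
    rw [intervalIntegral.integral_finsetSum (fun i _ => hii i), ← Finset.sum_neg_distrib]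
    refine (Finset.sum_le_sum fun i _ => e1 i).trans ?_
    rw [← integral_finsetSum]
    · have : ∫ x, (1:ℝ) ∂(stdGaussian n) = 1 := by simp
      rw [← this]
      refine integral_mono_of_nonneg ?_ (integrable_const _) ?_
      · filter_upwards with x
        exact Finset.sum_nonneg fun i _ => mul_self_nonneg _
      · filter_upwards with x
        have h1 := EuclideanSpace.real_norm_sq_eq (nrm x)
        have h2 := nrm_norm_le x
        have : ∑ i, nrm x i * nrm x i = ‖nrm x‖ ^ 2 := by
          rw [h1]; exact Finset.sum_congr rfl fun i _ => by ring
        rw [this]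
        nlinarith [norm_nonneg (nrm x)]
    · intro i _
      obtain ⟨B, hB⟩ := (coord_dirLip i).bounded
      have m := (coord_dirLip i).measurable
      refine Integrable.of_bound (m.mul m).aestronglyMeasurable (B * B) ?_
      filter_upwards with x
      rw [norm_mul]
      exact mul_le_mul (hB x) (hB x) (abs_nonneg _) ((abs_nonneg _).trans (hB x))

theorem cov_ineq {n : ℕ} (hn : 3 ≤ n) {F H D : EuclideanSpace ℝ (Fin n) → ℝ} {L C : ℝ}
    (hF : DirLip F 1) (hH : DirLip H L) (hD : Measurable D) (hDC : ∀ x, |D x| ≤ C)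
    (hD0 : ∀ x, 0 ≤ D x)
    (hDH : ∀ᵐ X ∂(stdGaussian n), ‖fderiv ℝ H X‖ ≤ D (nrm X) * ‖X‖⁻¹) :
    ∫ x, F x * H x ∂(stdGaussian n) - (∫ x, F x ∂(stdGaussian n)) * ∫ x, H x ∂(stdGaussian n) ≤
      (1 / ((n:ℝ) - 1)) * ∫ X, D (nrm X) ∂(stdGaussian n) := by
  have hpi : (0:ℝ) ≤ π / 2 := by positivity
  have hn' : (0:ℝ) < (n:ℝ) - 1 := by
    have : (3:ℝ) ≤ n := by exact_mod_cast hn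
    linarith
  obtain ⟨B, hB⟩ := hF.bounded
  obtain ⟨c1, c2⟩ := lemC hn
  rw [cov_id hn hF.measurable hB hH, ← intervalIntegral.integral_neg]
  have hk : 0 ≤ (1 / ((n:ℝ) - 1)) * ∫ X, D (nrm X) ∂(stdGaussian n) :=
    mul_nonneg (by positivity) (integral_nonneg fun x => hD0 _)
  have hii : IntervalIntegrable (fun s => ∫ p, F (cos s • p.1 - sin s • p.2) *
      fderiv ℝ H p.1 p.2 ∂((stdGaussian n).prod (stdGaussian n))) volume 0 (π/2) := by
    rw [intervalIntegrable_iff_integrableOn_Ioc_of_le hpi]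
    exact (cov_int hn hF.measurable hB hH
      (volume.restrict (Set.Ioc 0 (π/2)))).integral_prod_left
  refine (intervalIntegral.integral_mono_on hpi hii.neg
    ((c1.neg).const_mul ((1 / ((n:ℝ) - 1)) * ∫ X, D (nrm X) ∂(stdGaussian n))) ?_).trans ?_
  · intro s hs
    exact lemB hn hF hH hD hDC hDH (sin_nonneg_of_nonneg_of_le_pi hs.1 (by linarith [hs.2, pi_pos]))
  · rw [intervalIntegral.integral_const_mul]
    have := mul_le_mul_of_nonneg_left c2 hk
    rw [mul_one] at this
    exact this

lemma exp_sq_lip {κ r : ℝ} (hκ : 0 ≤ κ) {a b : ℝ} (ha : a ∈ Set.Icc 0 r)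
    (hb : b ∈ Set.Icc 0 r) :
    |exp (κ * a ^ 2 / 2) - exp (κ * b ^ 2 / 2)| ≤ exp (κ * r ^ 2 / 2) * (κ * r) * |a - b| := by
  have hd : ∀ x ∈ Set.Icc 0 r, HasDerivWithinAt (fun x : ℝ => exp (κ * x ^ 2 / 2))
      (exp (κ * x ^ 2 / 2) * (κ * x)) (Set.Icc 0 r) x := by
    intro x _
    have h1 : HasDerivAt (fun x : ℝ => κ * x ^ 2 / 2) (κ * x) x := by
      have := ((hasDerivAt_pow 2 x).const_mul κ).div_const 2
      refine this.congr_deriv ?_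
      push_cast; ring
    exact h1.exp.hasDerivWithinAt
  have hb' : ∀ x ∈ Set.Icc 0 r, ‖exp (κ * x ^ 2 / 2) * (κ * x)‖ ≤ exp (κ * r ^ 2 / 2) * (κ * r) := by
    intro x hx
    obtain ⟨h1, h2⟩ := hx
    rw [Real.norm_of_nonneg (by positivity)]
    gcongr
  exact Convex.norm_image_sub_le_of_norm_hasDerivWithin_le hd hb' (convex_Icc 0 r) hb ha

/-- The test function. -/
noncomputable def gfun (κ r t : ℝ) : ℝ :=
  exp (-(κ * r ^ 2 / 2)) * (exp (κ * (min (max t 0) r) ^ 2 / 2) - 1)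

/-- Its derivative. -/
noncomputable def dfun (κ r t : ℝ) : ℝ :=
  if 0 < t ∧ t < r then exp (-(κ * r ^ 2 / 2)) * (exp (κ * t ^ 2 / 2) * (κ * t)) else 0

lemma gfun_lip {κ r : ℝ} (hκ : 0 ≤ κ) (hr : 0 ≤ r) (a b : ℝ) :
    |gfun κ r a - gfun κ r b| ≤ (κ * r) * |a - b| := by
  have hm : ∀ t : ℝ, min (max t 0) r ∈ Set.Icc 0 r := fun t =>
    ⟨le_min (le_max_right _ _) hr, min_le_right _ _⟩
  have h1 := exp_sq_lip hκ (hm a) (hm b)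
  have h2 : |min (max a 0) r - min (max b 0) r| ≤ |a - b| := by
    have h3 := abs_min_sub_min_le_max (max a 0) r (max b 0) r
    have h4 := abs_max_sub_max_le_abs a b 0
    rw [sub_self, abs_zero, max_eq_left (abs_nonneg (max a 0 - max b 0))] at h3
    exact h3.trans h4
  have e : gfun κ r a - gfun κ r b = exp (-(κ * r ^ 2 / 2)) *
    (exp (κ * (min (max a 0) r) ^ 2 / 2) - exp (κ * (min (max b 0) r) ^ 2 / 2)) := by
    unfold gfun; ring
  rw [e, abs_mul, abs_of_pos (exp_pos _)]
  calc _ ≤ exp (-(κ * r ^ 2 / 2)) * (exp (κ * r ^ 2 / 2) * (κ * r) * |a - b|) := by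
        gcongr
        exact h1.trans (by gcongr)
    _ = (κ * r) * |a - b| := by
        rw [← mul_assoc, ← mul_assoc, ← exp_add]; simp

lemma gfun_mono {κ r : ℝ} (hκ : 0 ≤ κ) (hr : 0 ≤ r) : Monotone (gfun κ r) := by
  intro a b hab
  have : 0 ≤ min (max a 0) r := le_min (le_max_right _ _) hr
  unfold gfun
  gcongr

lemma gfun_neg {κ r t : ℝ} (hr : 0 ≤ r) (ht : t ≤ 0) : gfun κ r t = 0 := by
  simp [gfun, max_eq_right ht, hr]

lemma gfun_big {κ r t : ℝ} (hr : 0 ≤ r) (ht : r ≤ t) :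
    gfun κ r t = 1 - exp (-(κ * r ^ 2 / 2)) := by
  rw [gfun, max_eq_left (hr.trans ht), min_eq_right ht, mul_sub, ← exp_add]; simp

lemma gfun_mid {κ r t : ℝ} (ht : 0 < t) (ht' : t < r) :
    gfun κ r t = exp (-(κ * r ^ 2 / 2)) * (exp (κ * t ^ 2 / 2) - 1) := by
  rw [gfun, max_eq_left ht.le, min_eq_left ht'.le]

lemma dfun_nonneg {κ r : ℝ} (hκ : 0 ≤ κ) (t : ℝ) : 0 ≤ dfun κ r t := by
  unfold dfun
  split_ifs with h
  · have := h.1.le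
    positivity
  · exact le_rfl

lemma dfun_bdd {κ r : ℝ} (hκ : 0 ≤ κ) (hr : 0 ≤ r) (t : ℝ) : |dfun κ r t| ≤ κ * r := by
  rw [abs_of_nonneg (dfun_nonneg hκ t)]
  unfold dfun
  split_ifs with h
  · obtain ⟨h1, h2⟩ := h
    calc _ ≤ exp (-(κ * r ^ 2 / 2)) * (exp (κ * r ^ 2 / 2) * (κ * r)) := by gcongr
      _ = κ * r := by rw [← mul_assoc, ← exp_add]; simp
  · positivity

lemma dfun_meas (κ r : ℝ) : Measurable (dfun κ r) := by
  unfold dfun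
  refine Measurable.ite ?_ (by fun_prop) measurable_const
  exact measurableSet_Ioo

lemma gd_id {κ r : ℝ} (hκ : 0 < κ) (hr : 0 ≤ r) (t : ℝ) :
    t * gfun κ r t - (1 / κ) * dfun κ r t =
      (if r ≤ t then t else 0) - exp (-(κ * r ^ 2 / 2)) * max t 0 := by
  rcases le_or_gt t 0 with h | h
  · rw [gfun_neg hr h, dfun, if_neg (by intro h'; linarith [h'.1]), max_eq_right h]
    split_ifs with h2
    · have : t = 0 := by linarith
      simp [this]
    · simp
  · rw [max_eq_left h.le]
    rcases le_or_gt r t with h2 | h2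
    · rw [gfun_big hr h2, dfun, if_neg (by intro h'; linarith [h'.2]), if_pos h2]
      ring
    · rw [gfun_mid h h2, dfun, if_pos ⟨h, h2⟩, if_neg (by linarith)]
      field_simp
      ring

lemma one_side {n : ℕ} (hn : 3 ≤ n) {F : EuclideanSpace ℝ (Fin n) → ℝ} (hF : DirLip F 1)
    (h0 : ∫ x, F x ∂(stdGaussian n) = 0) {r : ℝ} (hr : 0 < r) :
    r * (stdGaussian n).real {x | r ≤ F x} ≤
      exp (-(((n:ℝ) - 1) * r ^ 2 / 2)) * ∫ x, max (F x) 0 ∂(stdGaussian n) := by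
  set κ : ℝ := (n:ℝ) - 1 with hκ
  have hκ0 : 0 < κ := by
    have : (3:ℝ) ≤ n := by exact_mod_cast hn
    linarith
  set c := exp (-(κ * r ^ 2 / 2)) with hc
  obtain ⟨B, hB⟩ := hF.bounded
  have mF := hF.measurable
  have hnn : ∀ X : EuclideanSpace ℝ (Fin n), X ≠ 0 → F (nrm X) = F X := by
    intro X hX
    rw [nrm]
    exact hF.smul_eq hX (inv_pos.2 (norm_pos_iff.2 hX))
  have hH : DirLip (fun x => gfun κ r (F x)) (κ * r) := by
    refine ⟨by positivity, fun x y hx hy => (gfun_lip hκ0.le hr.le _ _).trans ?_⟩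
    have := hF.2 x y hx hy
    rw [one_mul] at this
    gcongr
  have hDH : ∀ᵐ X ∂(stdGaussian n), ‖fderiv ℝ (fun x => gfun κ r (F x)) X‖ ≤
      dfun κ r (F (nrm X)) * ‖X‖⁻¹ := by
    filter_upwards [gauss_ae_ne hn, (gauss_ac n).ae_le (hF.ae_diff hn)] with X hX hd
    rw [hnn X hX]
    by_cases h : 0 < F X ∧ F X < r
    · obtain ⟨h1, h2⟩ := h
      have ev : (fun x => gfun κ r (F x)) =ᶠ[nhds X]
          (fun x => c * (exp (κ * F x ^ 2 / 2) - 1)) := by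
        filter_upwards [hd.continuousAt (Ioo_mem_nhds h1 h2)] with x hx
        exact gfun_mid hx.1 hx.2
      have hdt : HasDerivAt (fun t : ℝ => c * (exp (κ * t ^ 2 / 2) - 1))
          (c * (exp (κ * F X ^ 2 / 2) * (κ * F X))) (F X) := by
        have h1 : HasDerivAt (fun x : ℝ => κ * x ^ 2 / 2) (κ * F X) (F X) := by
          have := ((hasDerivAt_pow 2 (F X)).const_mul κ).div_const 2
          refine this.congr_deriv ?_
          push_cast; ring
        exact (h1.exp.sub_const 1).const_mul c
      have h3 := hdt.comp_hasFDerivAt X hd.hasFDerivAt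
      rw [ev.fderiv_eq]
      have h4 := h3.fderiv
      change ‖fderiv ℝ ((fun t : ℝ => c * (exp (κ * t ^ 2 / 2) - 1)) ∘ F) X‖ ≤ _
      rw [h4, norm_smul, dfun, if_pos ⟨h1, h2⟩, Real.norm_of_nonneg (by positivity)]
      have h5 := hF.fderiv_le hX
      rw [one_div] at h5
      gcongr
    · have : fderiv ℝ (fun x => gfun κ r (F x)) X = 0 := by
        rcases le_or_gt (F X) 0 with h1 | h1
        · refine IsLocalMin.fderiv_eq_zero ?_
          filter_upwards with x
          rw [gfun_neg hr.le h1, ← gfun_neg (κ := κ) hr.le (min_le_right (F x) 0)]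
          exact gfun_mono hκ0.le hr.le (min_le_left _ _)
        · have h2 : r ≤ F X := by
            by_contra h3; exact h ⟨h1, not_le.1 h3⟩
          refine IsLocalMax.fderiv_eq_zero ?_
          filter_upwards with x
          rw [gfun_big hr.le h2, ← gfun_big (κ := κ) hr.le (le_max_right (F x) r)]
          exact gfun_mono hκ0.le hr.le (le_max_left _ _)
      rw [this, norm_zero, dfun, if_neg h, zero_mul]
  have key := cov_ineq hn hF hH (D := fun x => dfun κ r (F x)) (C := κ * r)
    ((dfun_meas κ r).comp mF) (fun x => dfun_bdd hκ0.le hr.le _)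
    (fun x => dfun_nonneg hκ0.le _) hDH
  rw [h0, zero_mul, sub_zero, ← hκ] at key
  have e1 : ∫ X, dfun κ r (F (nrm X)) ∂(stdGaussian n) = ∫ X, dfun κ r (F X) ∂(stdGaussian n) := by
    refine integral_congr_ae ?_
    filter_upwards [gauss_ae_ne hn] with X hX
    rw [hnn X hX]
  rw [e1, ← integral_const_mul] at key
  have iF : Integrable F (stdGaussian n) := Integrable.of_bound mF.aestronglyMeasurable B
    (by filter_upwards with x using hB x)
  have i1 : Integrable (fun x => F x * gfun κ r (F x)) (stdGaussian n) := by
    obtain ⟨B', hB'⟩ := hH.bounded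
    exact iF.mul_bdd (c := B') hH.measurable.aestronglyMeasurable
      (by filter_upwards with x using hB' x)
  have i2 : Integrable (fun x => (1 / κ) * dfun κ r (F x)) (stdGaussian n) :=
    (Integrable.of_bound ((dfun_meas κ r).comp mF).aestronglyMeasurable (κ * r)
      (by filter_upwards with x using dfun_bdd hκ0.le hr.le _)).const_mul _
  have mS : MeasurableSet {x | r ≤ F x} := measurableSet_le measurable_const mF
  have i3 : Integrable (fun x => if r ≤ F x then F x else 0) (stdGaussian n) :=
    (iF.indicator mS).congr (by filter_upwards with x; simp [Set.indicator_apply])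
  have i4 : Integrable (fun x => max (F x) 0) (stdGaussian n) := iF.pos_part
  have i5 := i4.const_mul c
  have k2 : ∫ x, (if r ≤ F x then F x else 0) ∂(stdGaussian n) -
      c * ∫ x, max (F x) 0 ∂(stdGaussian n) ≤ 0 := by
    rw [← integral_const_mul, ← integral_sub i3 i5]
    simp_rw [hc, ← gd_id hκ0 hr.le]
    rw [integral_sub i1 i2]
    linarith
  have k3 : r * (stdGaussian n).real {x | r ≤ F x} ≤
      ∫ x, (if r ≤ F x then F x else 0) ∂(stdGaussian n) := by
    have : ∫ x, Set.indicator {x | r ≤ F x} (fun _ => r) x ∂(stdGaussian n) =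
        r * (stdGaussian n).real {x | r ≤ F x} := by
      rw [integral_indicator_const _ mS, smul_eq_mul, mul_comm]
    rw [← this]
    refine integral_mono ((integrable_const r).indicator mS) i3 fun x => ?_
    by_cases hx : r ≤ F x <;> simp [Set.indicator_apply, hx]
  linarith

lemma two_side {n : ℕ} (hn : 3 ≤ n) {F : EuclideanSpace ℝ (Fin n) → ℝ} (hF : DirLip F 1)
    (h0 : ∫ x, F x ∂(stdGaussian n) = 0) {r : ℝ} (hr : 0 < r) :
    (stdGaussian n).real {x | r ≤ |F x|} ≤
      1 / r * exp (-((n:ℝ) - 2) * r ^ 2 / 2) * ∫ x, |F x| ∂(stdGaussian n) := by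
  have hG : DirLip (fun x => - F x) 1 := ⟨zero_le_one, fun x y hx hy => by
    rw [neg_sub_neg, abs_sub_comm]; exact hF.2 x y hx hy⟩
  have a := one_side hn hF h0 hr
  have b := one_side hn hG (by rw [integral_neg, h0, neg_zero]) hr
  obtain ⟨B, hB⟩ := hF.bounded
  have iF : Integrable F (stdGaussian n) := Integrable.of_bound hF.measurable.aestronglyMeasurable B
    (by filter_upwards with x using hB x)
  have e : ∫ x, |F x| ∂(stdGaussian n) =
      ∫ x, max (F x) 0 ∂(stdGaussian n) + ∫ x, max (- F x) 0 ∂(stdGaussian n) := by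
    rw [← integral_add iF.pos_part iF.neg_part]
    congr 1 with x
    rcases le_total (F x) 0 with h | h
    · rw [abs_of_nonpos h, max_eq_right h, max_eq_left (by linarith), zero_add]
    · rw [abs_of_nonneg h, max_eq_left h, max_eq_right (by linarith), add_zero]
  have u : (stdGaussian n).real {x | r ≤ |F x|} ≤
      (stdGaussian n).real {x | r ≤ F x} + (stdGaussian n).real {x | r ≤ - F x} := by
    refine le_trans (measureReal_mono ?_) (measureReal_union_le _ _)
    intro x hx
    exact (le_abs (a := r) (b := F x)).1 hx
  have hc : exp (-(((n:ℝ) - 1) * r ^ 2 / 2)) ≤ exp (-((n:ℝ) - 2) * r ^ 2 / 2) := by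
    apply exp_le_exp.2
    nlinarith [sq_nonneg r]
  have hI : 0 ≤ ∫ x, |F x| ∂(stdGaussian n) := integral_nonneg fun x => abs_nonneg _
  have f1 := mul_le_mul_of_nonneg_right hc hI
  have f2 := mul_le_mul_of_nonneg_left u hr.le
  have f3 : r * (stdGaussian n).real {x | r ≤ |F x|} ≤
      exp (-((n:ℝ) - 2) * r ^ 2 / 2) * ∫ x, |F x| ∂(stdGaussian n) := by
    rw [e] at f1 ⊢
    nlinarith
  rw [mul_assoc, one_div, inv_mul_eq_div, le_div_iff₀ hr, mul_comm]
  exact f3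

/-- Deviation inequality on the sphere: for `f` with Lipschitz constant at most 1
on `S^{n-1}` and mean `m`,
`σ{|f - m| ≥ r} ≤ (1/r) e^{-(n-2)r²/2} ∫ |f - m| dσ`. -/
theorem statement13 (n : ℕ) (hn : 3 ≤ n) (f : EuclideanSpace ℝ (Fin n) → ℝ)
    (hf : ∀ x ∈ Metric.sphere (0 : EuclideanSpace ℝ (Fin n)) 1,
      ∀ y ∈ Metric.sphere (0 : EuclideanSpace ℝ (Fin n)) 1, |f x - f y| ≤ ‖x - y‖)
    (m : ℝ) (hm : m = ∫ x, f x ∂(sphereUniform n)) (r : ℝ) (hr : 0 < r) :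
    sphereUniform n {x | r ≤ |f x - m|} ≤
      ENNReal.ofReal ((1 / r) * Real.exp (-((n : ℝ) - 2) * r ^ 2 / 2) *
        ∫ x, |f x - m| ∂(sphereUniform n)) := by
  have hσ : sphereUniform n = (stdGaussian n).map nrm := rfl
  have hs : ∀ x : EuclideanSpace ℝ (Fin n), x ≠ 0 → nrm x ∈ Metric.sphere (0 : EuclideanSpace ℝ (Fin n)) 1 :=
    fun x hx => by rw [mem_sphere_zero_iff_norm]; exact nrm_norm hx
  have hG : DirLip (fun x => f (nrm x)) 1 := ⟨zero_le_one, fun x y hx hy => by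
    rw [one_mul]; exact hf _ (hs x hx) _ (hs y hy)⟩
  have hF : DirLip (fun x => f (nrm x) - m) 1 := ⟨zero_le_one, fun x y hx hy => by
    rw [sub_sub_sub_cancel_right]; exact hG.2 x y hx hy⟩
  have hnn : ∀ x : EuclideanSpace ℝ (Fin n), x ≠ 0 → nrm (nrm x) = nrm x := fun x hx => by
    rw [nrm, nrm_norm hx, inv_one, one_smul]
  have hae : ∀ᵐ x ∂(sphereUniform n), f x = f (nrm x) := by
    have : ∀ᵐ x ∂(sphereUniform n), x ∈ Metric.sphere (0 : EuclideanSpace ℝ (Fin n)) 1 := by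
      rw [hσ]
      refine (ae_map_iff measurable_nrm.aemeasurable
        (p := fun x => x ∈ Metric.sphere (0 : EuclideanSpace ℝ (Fin n)) 1)
        Metric.isClosed_sphere.measurableSet).2 ?_
      filter_upwards [gauss_ae_ne hn] with x hx using hs x hx
    filter_upwards [this] with x hx
    rw [mem_sphere_zero_iff_norm] at hx
    rw [nrm, hx, inv_one, one_smul]
  have tr : ∀ φ : ℝ → ℝ, Measurable φ →
      ∫ x, φ (f x) ∂(sphereUniform n) = ∫ x, φ (f (nrm x)) ∂(stdGaussian n) := by
    intro φ hφ
    have h1 : ∫ x, φ (f x) ∂(sphereUniform n) = ∫ x, φ (f (nrm x)) ∂(sphereUniform n) := by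
      refine integral_congr_ae ?_
      filter_upwards [hae] with x hx
      rw [← hx]
    rw [h1, hσ]
    refine (integral_map measurable_nrm.aemeasurable (f := fun x => φ (f (nrm x)))
      (hφ.comp hG.measurable).aestronglyMeasurable).trans ?_
    refine integral_congr_ae ?_
    filter_upwards [gauss_ae_ne hn] with x hx
    rw [hnn x hx]
  obtain ⟨B, hB⟩ := hG.bounded
  have iG : Integrable (fun x => f (nrm x)) (stdGaussian n) :=
    Integrable.of_bound hG.measurable.aestronglyMeasurable B (by filter_upwards with x using hB x)
  have h0 : ∫ x, (f (nrm x) - m) ∂(stdGaussian n) = 0 := by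
    have h2 := tr (fun t => t) measurable_id
    rw [integral_sub iG (integrable_const m), ← h2, ← hm]
    simp
  have main := two_side hn hF h0 hr
  rw [tr (fun t => |t - m|) (by fun_prop)]
  have e2 : sphereUniform n {x | r ≤ |f x - m|} = (stdGaussian n) {x | r ≤ |f (nrm x) - m|} := by
    have h1 : sphereUniform n {x | r ≤ |f x - m|} = sphereUniform n {x | r ≤ |f (nrm x) - m|} := by
      refine measure_congr ?_
      filter_upwards [hae] with x hx
      apply propext
      change r ≤ |f x - m| ↔ r ≤ |f (nrm x) - m|
      rw [← hx]
    have mS : MeasurableSet {x | r ≤ |f (nrm x) - m|} :=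
      measurableSet_le measurable_const (continuous_abs.measurable.comp hF.measurable)
    rw [h1, hσ, Measure.map_apply measurable_nrm mS]
    refine measure_congr ?_
    filter_upwards [gauss_ae_ne hn] with x hx
    apply propext
    change r ≤ |f (nrm (nrm x)) - m| ↔ r ≤ |f (nrm x) - m|
    rw [hnn x hx]
  rw [e2, ← ofReal_measureReal]
  exact ENNReal.ofReal_le_ofReal main
end

section
/- Let n ≥ 1 and define q_n(x,y) = (2π)^{-n} ∫₀¹ (1-t)(1-t²)^{-n/2} exp(-(|x|² + |y|² - 2t⟨x,y⟩)/(2(1-t²))) dt for x, y ∈ ℝⁿ. Then for all twice continuously differentiable functions u, v : ℝⁿ → ℝ with ∫ ‖u''‖²_HS dγ_n < ∞ and ∫ ‖v''‖²_HS dγ_n < ∞, one has cov_{γ_n}(u,v) = ⟨∫ ∇u dγ_n, ∫ ∇v dγ_n⟩ + ∫_{ℝⁿ}∫_{ℝⁿ} ⟨u''(x), v''(y)⟩ q_n(x,y) dx dy, where ⟨A,B⟩ = Tr(AB) is the Hilbert–Schmidt inner product of symmetric matrices. -/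
open MeasureTheory Real
open scoped RealInnerProductSpace

/-- The `(i,j)` entry of the Hessian matrix of `u` at `x`. -/
noncomputable def hessEntry (n : ℕ) (u : EuclideanSpace ℝ (Fin n) → ℝ)
    (x : EuclideanSpace ℝ (Fin n)) (i j : Fin n) : ℝ :=
  (fderiv ℝ (fderiv ℝ u) x (EuclideanSpace.single i 1)) (EuclideanSpace.single j 1)

/-- The second-order mixing density `q_n(x,y)`. -/
noncomputable def qdens (n : ℕ) (x y : EuclideanSpace ℝ (Fin n)) : ℝ :=
  (2 * π) ^ (-(n : ℝ)) *
    ∫ t in Set.Ioo (0 : ℝ) 1,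
      (1 - t) * (1 - t ^ 2) ^ (-(n : ℝ) / 2) *
        Real.exp (-(‖x‖ ^ 2 + ‖y‖ ^ 2 - 2 * t * ⟪x, y⟫) / (2 * (1 - t ^ 2)))


open MeasureTheory Real
open scoped RealInnerProductSpace

namespace GCov

/-- Gaussian density. -/
noncomputable def rho (n : ℕ) (x : EuclideanSpace ℝ (Fin n)) : ℝ :=
  (2 * π) ^ (-(n : ℝ) / 2) * Real.exp (-‖x‖ ^ 2 / 2)

lemma rho_pos (n : ℕ) (x : EuclideanSpace ℝ (Fin n)) : 0 < rho n x := by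
  unfold rho; positivity

lemma rho_cont (n : ℕ) : Continuous (rho n) := by
  unfold rho; fun_prop

lemma std_eq (n : ℕ) : stdGaussian n = volume.withDensity (fun x => ENNReal.ofReal (rho n x)) := rfl

lemma integral_std (n : ℕ) (f : EuclideanSpace ℝ (Fin n) → ℝ) :
    ∫ x, f x ∂(stdGaussian n) = ∫ x, rho n x * f x := by
  rw [std_eq, integral_withDensity_eq_integral_toReal_smul₀]
  · refine integral_congr_ae (Filter.Eventually.of_forall fun x => ?_)
    simp [ENNReal.toReal_ofReal (rho_pos n x).le]
  · exact (rho_cont n).measurable.ennreal_ofReal.aemeasurable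
  · exact Filter.Eventually.of_forall fun x => ENNReal.ofReal_lt_top

lemma integrable_std (n : ℕ) (f : EuclideanSpace ℝ (Fin n) → ℝ) :
    Integrable f (stdGaussian n) ↔ Integrable (fun x => rho n x * f x) := by
  rw [std_eq, integrable_withDensity_iff_integrable_smul₀']
  · refine integrable_congr (Filter.Eventually.of_forall fun x => ?_)
    simp [ENNReal.toReal_ofReal (rho_pos n x).le]
  · exact (rho_cont n).measurable.ennreal_ofReal.aemeasurable
  · exact Filter.Eventually.of_forall fun x => ENNReal.ofReal_lt_top

lemma integral_rho (n : ℕ) : ∫ x, rho n x = 1 := by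
  unfold rho
  rw [integral_const_mul]
  have := GaussianFourier.integral_rexp_neg_mul_sq_norm (V := EuclideanSpace ℝ (Fin n)) (b := 1/2) (by norm_num)
  have h2 : ∀ x : EuclideanSpace ℝ (Fin n), -‖x‖ ^ 2 / 2 = -(1/2) * ‖x‖^2 := fun x => by ring
  simp_rw [h2]
  rw [this, finrank_euclideanSpace, Fintype.card_fin, show π / (1/2) = 2 * π by ring,
    ← Real.rpow_add (by positivity)]
  rw [show -(n:ℝ)/2 + n/2 = 0 by ring, Real.rpow_zero]

lemma integrable_rho (n : ℕ) : Integrable (rho n) := by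
  by_contra h
  have := integral_rho n
  rw [integral_undef h] at this
  norm_num at this

instance isProb (n : ℕ) : IsProbabilityMeasure (stdGaussian n) := by
  constructor
  rw [std_eq, withDensity_apply _ MeasurableSet.univ, Measure.restrict_univ,
    ← ofReal_integral_eq_lintegral_ofReal (integrable_rho n)
      (Filter.Eventually.of_forall fun x => (rho_pos n x).le), integral_rho]
  simp

lemma std_eq_std (n : ℕ) : stdGaussian n =
    ProbabilityTheory.stdGaussian (EuclideanSpace ℝ (Fin n)) := by
  refine Measure.ext_of_charFun ?_
  ext t
  rw [ProbabilityTheory.charFun_stdGaussian, charFun_apply, std_eq,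
    integral_withDensity_eq_integral_toReal_smul₀
      (rho_cont n).measurable.ennreal_ofReal.aemeasurable
      (Filter.Eventually.of_forall fun x => ENNReal.ofReal_lt_top)]
  have h0 := GaussianFourier.integral_cexp_neg_mul_sq_norm_add
    (V := EuclideanSpace ℝ (Fin n)) (b := 1/2) (by norm_num) Complex.I t
  have h1 : ∀ x : EuclideanSpace ℝ (Fin n),
      (ENNReal.ofReal (rho n x)).toReal • Complex.exp (⟪x, t⟫ * Complex.I) =
      (((2 * π) ^ (-(n : ℝ) / 2) : ℝ) : ℂ) *
        Complex.exp (-(1/2) * ‖x‖ ^ 2 + Complex.I * ⟪t, x⟫) := by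
    intro x
    rw [ENNReal.toReal_ofReal (rho_pos n x).le, rho, Complex.exp_add, Complex.real_smul,
      real_inner_comm]
    push_cast
    rw [mul_assoc]
    congr 3
    · ring
    · ring
  simp_rw [h1]
  rw [integral_const_mul, h0, finrank_euclideanSpace, Fintype.card_fin, ← mul_assoc]
  have h3 : ((π:ℂ) / (1/2)) ^ ((n:ℂ)/2) = (((2 * π) ^ ((n : ℝ) / 2) : ℝ) : ℂ) := by
    rw [Complex.ofReal_cpow (by positivity)]
    push_cast
    congr 1
    ring
  rw [h3, ← Complex.ofReal_mul, ← Real.rpow_add (by positivity),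
    show -(n:ℝ)/2 + n/2 = 0 by ring, Real.rpow_zero, Complex.ofReal_one, one_mul]
  congr 1
  rw [Complex.I_sq]; ring

instance isGauss (n : ℕ) : ProbabilityTheory.IsGaussian (stdGaussian n) := by
  rw [std_eq_std]; infer_instance

/-- rotation is measure preserving -/
lemma rot_mp (n : ℕ) (θ : ℝ) : MeasurePreserving
    (fun p : EuclideanSpace ℝ (Fin n) × EuclideanSpace ℝ (Fin n) =>
      (cos θ • p.1 + sin θ • p.2, -sin θ • p.1 + cos θ • p.2))
    ((stdGaussian n).prod (stdGaussian n)) ((stdGaussian n).prod (stdGaussian n)) := by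
  refine ⟨by fun_prop, ?_⟩
  refine ProbabilityTheory.IsGaussian.map_rotation_eq_self (μ := stdGaussian n) ?_ θ
  rw [std_eq_std]
  exact ProbabilityTheory.integral_id_stdGaussian

lemma memLp_coord (n : ℕ) (i : Fin n) : MemLp (fun x : EuclideanSpace ℝ (Fin n) => x i) 2
    (stdGaussian n) := by
  have h := ProbabilityTheory.IsGaussian.memLp_id (stdGaussian n) 2 (by simp)
  refine h.mono (by fun_prop) (Filter.Eventually.of_forall fun x => ?_)
  exact PiLp.norm_apply_le x i

/-- Gaussian integration by parts. -/
lemma gauss_ibp (n : ℕ) (i : Fin n) (h : EuclideanSpace ℝ (Fin n) → ℝ) (hd : Differentiable ℝ h)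
    (h1 : Integrable h (stdGaussian n))
    (h2 : Integrable (fun x => h x * x i) (stdGaussian n))
    (h3 : Integrable (fun x => fderiv ℝ h x (EuclideanSpace.single i 1)) (stdGaussian n)) :
    ∫ x, h x * x i ∂(stdGaussian n) =
      ∫ x, fderiv ℝ h x (EuclideanSpace.single i 1) ∂(stdGaussian n) := by
  rw [integrable_std] at h1 h2 h3
  rw [integral_std, integral_std]
  have hr : ∀ x, HasFDerivAt (rho n) (-(rho n x) • innerSL ℝ x) x := by
    intro x
    have e1 : HasFDerivAt (fun x : EuclideanSpace ℝ (Fin n) => ‖x‖ ^ 2) (2 • innerSL ℝ x) x :=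
      (hasStrictFDerivAt_norm_sq x).hasFDerivAt
    have e2 := ((e1.const_mul (-(1/2))).exp).const_mul ((2 * π) ^ (-(n : ℝ) / 2))
    have : rho n = fun x : EuclideanSpace ℝ (Fin n) =>
        (2 * π) ^ (-(n : ℝ) / 2) * Real.exp (-(1/2) * ‖x‖ ^ 2) := by
      ext x; unfold rho; congr 2; ring
    rw [this]
    refine e2.congr_fderiv ?_
    ext v
    simp
    ring
  have key : ∀ x, fderiv ℝ (rho n) x (EuclideanSpace.single i 1) = -(rho n x * x i) := by
    intro x
    rw [(hr x).fderiv]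
    simp [EuclideanSpace.inner_single_right]
  have := integral_mul_fderiv_eq_neg_fderiv_mul_of_integrable (μ := volume) (f := h) (g := rho n)
    (v := EuclideanSpace.single i 1)
    (by simpa [mul_comm] using h3)
    (by simp_rw [key]; refine h2.neg.congr (Filter.Eventually.of_forall fun x => ?_); simp; ring)
    (by simpa [mul_comm] using h1) (fun x _ => hd x) (fun x _ => (hr x).differentiableAt)
  simp_rw [key] at this
  simp_rw [mul_neg, integral_neg] at this
  rw [neg_inj] at this
  calc _ = ∫ x, h x * (rho n x * x i) := by congr 1; ext x; ring
    _ = _ := by rw [this]; congr 1; ext x; ring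

end GCov

open MeasureTheory Real
open scoped RealInnerProductSpace

namespace GCov

/-- The rotation of the product space. -/
noncomputable def rot (n : ℕ) (θ : ℝ) (p : EuclideanSpace ℝ (Fin n) × EuclideanSpace ℝ (Fin n)) :
    EuclideanSpace ℝ (Fin n) × EuclideanSpace ℝ (Fin n) :=
  (cos θ • p.1 + sin θ • p.2, -sin θ • p.1 + cos θ • p.2)

/-- The product Gaussian measure. -/
noncomputable abbrev gg (n : ℕ) :
    Measure (EuclideanSpace ℝ (Fin n) × EuclideanSpace ℝ (Fin n)) :=
  (stdGaussian n).prod (stdGaussian n)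

/-- Partial derivative. -/
noncomputable def pd (n : ℕ) (i : Fin n) (f : EuclideanSpace ℝ (Fin n) → ℝ)
    (x : EuclideanSpace ℝ (Fin n)) : ℝ := fderiv ℝ f x (EuclideanSpace.single i 1)

lemma pd_cont {n : ℕ} (i : Fin n) {f : EuclideanSpace ℝ (Fin n) → ℝ} (hf : ContDiff ℝ 1 f) :
    Continuous (pd n i f) := by
  have := hf.continuous_fderiv (by norm_num)
  unfold pd
  fun_prop

lemma fderiv_eq_sum {n : ℕ} (f : EuclideanSpace ℝ (Fin n) → ℝ)
    (x w : EuclideanSpace ℝ (Fin n)) : fderiv ℝ f x w = ∑ i, pd n i f x * w i := by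
  have : w = ∑ i, w i • EuclideanSpace.single i (1:ℝ) := by
    have := (EuclideanSpace.basisFun (Fin n) ℝ).sum_repr w
    simpa using this.symm
  conv_lhs => rw [this]
  simp [pd, mul_comm]

lemma rot_mp' (n : ℕ) (θ : ℝ) : MeasurePreserving (rot n θ) (gg n) (gg n) := rot_mp n θ

lemma rot_cont (n : ℕ) : Continuous (fun q : ℝ × (EuclideanSpace ℝ (Fin n) × EuclideanSpace ℝ (Fin n)) =>
    rot n q.1 q.2) := by
  unfold rot; fun_prop

lemma rot_cont_left (n : ℕ) (p) : Continuous (fun α => rot n α p) := by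
  unfold rot; fun_prop

lemma rot_rot (n : ℕ) (θ : ℝ) (p) : rot n θ (rot n (-θ) p) = p := by
  unfold rot
  ext i
  · simp
    linear_combination (p.1 i) * (sin_sq_add_cos_sq θ)
  · simp
    linear_combination (p.2 i) * (sin_sq_add_cos_sq θ)

lemma rot_emb (n : ℕ) (θ : ℝ) : MeasurableEmbedding (rot n θ) := by
  have hc : ∀ θ, Continuous (rot n θ) := fun θ => by unfold rot; fun_prop
  exact (Homeomorph.mk ⟨rot n θ, rot n (-θ), fun p => by
    simpa using rot_rot n (-θ) p, fun p => rot_rot n θ p⟩ (hc _) (hc _)).measurableEmbedding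

lemma rotp_mp (n : ℕ) (a b : ℝ) : MeasurePreserving
    (fun q : ℝ × (EuclideanSpace ℝ (Fin n) × EuclideanSpace ℝ (Fin n)) => (q.1, rot n q.1 q.2))
    ((volume.restrict (Set.Ioc a b)).prod (gg n)) ((volume.restrict (Set.Ioc a b)).prod (gg n)) :=
  (MeasurePreserving.id _).skew_product (rot_cont n).measurable
    (Filter.Eventually.of_forall fun θ => (rot_mp' n θ).map_eq)

lemma memLp_rotp {n : ℕ} (a b : ℝ) {F : EuclideanSpace ℝ (Fin n) × EuclideanSpace ℝ (Fin n) → ℝ}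
    (hF : MemLp F 2 (gg n)) :
    MemLp (fun q : ℝ × (EuclideanSpace ℝ (Fin n) × EuclideanSpace ℝ (Fin n)) =>
      F (rot n q.1 q.2)) 2 ((volume.restrict (Set.Ioc a b)).prod (gg n)) :=
  (hF.comp_snd (volume.restrict (Set.Ioc a b))).comp_measurePreserving (rotp_mp n a b)

lemma memLp_rot {n : ℕ} (θ : ℝ) {F : EuclideanSpace ℝ (Fin n) × EuclideanSpace ℝ (Fin n) → ℝ}
    (hF : MemLp F 2 (gg n)) : MemLp (fun p => F (rot n θ p)) 2 (gg n) :=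
  hF.comp_measurePreserving (rot_mp' n θ)

lemma memLp_mulcoord {n : ℕ} {g : EuclideanSpace ℝ (Fin n) → ℝ} (hg : MemLp g 2 (stdGaussian n))
    (i : Fin n) : MemLp (fun p => g p.1 * p.2 i) 2 (gg n) := by
  rw [memLp_two_iff_integrable_sq]
  · have := hg.integrable_sq.mul_prod (memLp_coord n i).integrable_sq
    simpa [mul_pow] using this
  · exact hg.1.comp_fst.mul (by fun_prop)

/-- derivative along the rotation. -/
noncomputable def Sder (n : ℕ) (g : EuclideanSpace ℝ (Fin n) → ℝ)
    (p : EuclideanSpace ℝ (Fin n) × EuclideanSpace ℝ (Fin n)) : ℝ := ∑ i, pd n i g p.1 * p.2 i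

lemma memLp_Sder {n : ℕ} {g : EuclideanSpace ℝ (Fin n) → ℝ}
    (hg : ∀ i, MemLp (pd n i g) 2 (stdGaussian n)) : MemLp (Sder n g) 2 (gg n) := by
  unfold Sder
  exact memLp_finsetSum _ fun i _ => memLp_mulcoord (hg i) i

lemma Sder_cont {n : ℕ} {g : EuclideanSpace ℝ (Fin n) → ℝ} (hg : ContDiff ℝ 1 g) :
    Continuous (Sder n g) := by
  have := fun i => pd_cont i hg
  unfold Sder
  fun_prop

lemma ftc {n : ℕ} {g : EuclideanSpace ℝ (Fin n) → ℝ} (hg : ContDiff ℝ 1 g) (a b : ℝ)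
    (p : EuclideanSpace ℝ (Fin n) × EuclideanSpace ℝ (Fin n)) :
    ∫ α in a..b, Sder n g (rot n α p) = g (rot n b p).1 - g (rot n a p).1 := by
  refine intervalIntegral.integral_eq_sub_of_hasDerivAt (f := fun α => g (rot n α p).1) ?_ ?_
  · intro α _
    have h1 : HasDerivAt (fun α => (rot n α p).1) (rot n α p).2 α := by
      unfold rot
      exact ((hasDerivAt_cos α).smul_const p.1).add ((hasDerivAt_sin α).smul_const p.2)
    have h2 := ((hg.differentiable (by norm_num)) (rot n α p).1).hasFDerivAt.comp_hasDerivAt α h1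
    rw [fderiv_eq_sum] at h2
    exact h2
  · apply Continuous.intervalIntegrable
    exact (Sder_cont hg).comp (rot_cont_left n p)

lemma sq_integral_le {S : ℝ → ℝ} (hS : Continuous S) {a b : ℝ} (hab : a < b) :
    (∫ α in a..b, S α) ^ 2 ≤ (b - a) * ∫ α in a..b, S α ^ 2 := by
  set I := ∫ α in a..b, S α with hI
  have h0 : 0 ≤ ∫ α in a..b, (S α - I / (b - a)) ^ 2 :=
    intervalIntegral.integral_nonneg hab.le fun _ _ => sq_nonneg _
  have h1 : ∫ α in a..b, (S α - I / (b - a)) ^ 2 =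
      (∫ α in a..b, S α ^ 2) - 2 * (I / (b-a)) * I + (b - a) * (I/(b-a))^2 := by
    have : ∀ α, (S α - I / (b - a)) ^ 2 = S α ^ 2 - 2 * (I / (b-a)) * S α + (I/(b-a))^2 :=
      fun α => by ring
    simp_rw [this]
    rw [intervalIntegral.integral_add, intervalIntegral.integral_sub,
      intervalIntegral.integral_const_mul, intervalIntegral.integral_const, ← hI, smul_eq_mul]
    all_goals apply Continuous.intervalIntegrable; fun_prop
  rw [h1] at h0
  have hba : 0 < b - a := by linarith
  have h2 : (∫ α in a..b, S α ^ 2) - 2 * (I / (b-a)) * I + (b - a) * (I/(b-a))^2 =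
     (∫ α in a..b, S α ^ 2) - I^2/(b-a) := by field_simp; ring
  rw [h2, sub_nonneg, div_le_iff₀ hba] at h0
  linarith

/-- A `C¹` function with square integrable gradient is square integrable. -/
lemma memLp_of_grad {n : ℕ} {g : EuclideanSpace ℝ (Fin n) → ℝ} (hg : ContDiff ℝ 1 g)
    (h : ∀ i, MemLp (pd n i g) 2 (stdGaussian n)) : MemLp g 2 (stdGaussian n) := by
  have hc := hg.continuous
  have h1 := ((memLp_rotp 0 (π/2) (memLp_Sder h)).integrable_sq).integral_prod_right
  have h2 : Integrable (fun p : EuclideanSpace ℝ (Fin n) × EuclideanSpace ℝ (Fin n) =>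
      (g p.1 - g p.2) ^ 2) (gg n) := by
    refine (h1.const_mul (π/2)).mono' (by fun_prop) (Filter.Eventually.of_forall fun p => ?_)
    have e := ftc hg 0 (π/2) p
    have e2 := sq_integral_le (S := fun α => Sder n g (rot n α p))
      ((Sder_cont hg).comp (rot_cont_left n p))
      (a := 0) (b := π/2) (by positivity)
    rw [e, intervalIntegral.integral_of_le (by positivity)] at e2
    simp [rot] at e2
    rw [Real.norm_of_nonneg (sq_nonneg _), show (g p.1 - g p.2)^2 = (g p.2 - g p.1)^2 by ring]
    simpa [rot] using e2
  obtain ⟨y, hy⟩ := h2.prod_left_ae.exists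
  have h3 : MemLp (fun x => g x - g y) 2 (stdGaussian n) := by
    rw [memLp_two_iff_integrable_sq (by fun_prop)]
    exact hy
  have h4 := h3.add (memLp_const (g y))
  convert h4 using 1
  ext x
  simp

/-- The Mehler bilinear form. -/
noncomputable def T (n : ℕ) (θ : ℝ) (h k : EuclideanSpace ℝ (Fin n) → ℝ) : ℝ :=
  ∫ p, h p.1 * k (rot n θ p).1 ∂(gg n)

lemma T_integrable {n : ℕ} (θ : ℝ) {h k : EuclideanSpace ℝ (Fin n) → ℝ}
    (hh : MemLp h 2 (stdGaussian n)) (hk : MemLp k 2 (stdGaussian n)) :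
    Integrable (fun p => h p.1 * k (rot n θ p).1) (gg n) :=
  (hh.comp_fst (stdGaussian n)).integrable_mul
    (memLp_rot θ (F := fun p => k p.1) (hk.comp_fst (stdGaussian n)))

lemma T_integrable_param {n : ℕ} (a b : ℝ) {h k : EuclideanSpace ℝ (Fin n) → ℝ}
    (hh : MemLp h 2 (stdGaussian n)) (hk : MemLp k 2 (stdGaussian n)) :
    Integrable (fun θ => T n θ h k) (volume.restrict (Set.Ioc a b)) := by
  have h1 := ((hh.comp_fst (stdGaussian n)).comp_snd (volume.restrict (Set.Ioc a b))).integrable_mul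
    (memLp_rotp a b (F := fun p => k p.1) (hk.comp_fst (stdGaussian n)))
  exact h1.integral_prod_left

lemma T_half {n : ℕ} (h k : EuclideanSpace ℝ (Fin n) → ℝ) :
    T n (π/2) h k = (∫ x, h x ∂(stdGaussian n)) * ∫ x, k x ∂(stdGaussian n) := by
  simp only [T, rot, cos_pi_div_two, sin_pi_div_two, zero_smul, one_smul, zero_add]
  exact integral_prod_mul h k

lemma T_zero {n : ℕ} (h k : EuclideanSpace ℝ (Fin n) → ℝ) :
    T n 0 h k = ∫ x, h x * k x ∂(stdGaussian n) := by
  simp only [T, rot, cos_zero, sin_zero, zero_smul, one_smul, add_zero]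
  rw [integral_fun_fst (f := fun x => h x * k x)]
  simp

/-- Integration by parts in the rotated variable. -/
lemma rot_ibp {n : ℕ} (θ : ℝ) {f k : EuclideanSpace ℝ (Fin n) → ℝ} (hf : ContDiff ℝ 1 f)
    (i : Fin n) (h1 : MemLp f 2 (stdGaussian n)) (h2 : MemLp (pd n i f) 2 (stdGaussian n))
    (hk : MemLp k 2 (stdGaussian n)) :
    ∫ p, f p.1 * (k (rot n θ p).1 * (rot n θ p).2 i) ∂(gg n) = - sin θ * T n θ (pd n i f) k := by
  have e1 : ∀ F : EuclideanSpace ℝ (Fin n) × EuclideanSpace ℝ (Fin n) → ℝ,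
      ∫ p, F p ∂(gg n) = ∫ p, F (rot n (-θ) p) ∂(gg n) := fun F =>
    ((rot_mp' n (-θ)).integral_comp (rot_emb n (-θ)) F).symm
  have e2 : ∀ F : EuclideanSpace ℝ (Fin n) × EuclideanSpace ℝ (Fin n) → ℝ,
      Integrable F (gg n) → Integrable (fun p => F (rot n (-θ) p)) (gg n) := fun F hF =>
    (rot_mp' n (-θ)).integrable_comp_of_integrable hF
  have i1 : Integrable (fun p : EuclideanSpace ℝ (Fin n) × EuclideanSpace ℝ (Fin n) => f p.1)
      (gg n) := (h1.integrable (by norm_num)).comp_fst _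
  have i2 : Integrable (fun p => f p.1 * (k (rot n θ p).1 * (rot n θ p).2 i)) (gg n) :=
    (h1.comp_fst (stdGaussian n)).integrable_mul (memLp_rot θ (memLp_mulcoord hk i))
  have i3 := T_integrable θ h2 hk
  have i4 : Integrable (fun p : EuclideanSpace ℝ (Fin n) × EuclideanSpace ℝ (Fin n) =>
    pd n i f p.1) (gg n) := (h2.integrable (by norm_num)).comp_fst _
  have j1 := e2 _ i1
  have j2 := e2 _ i2
  have j3 := e2 _ i3
  have j4 := e2 _ i4
  unfold T
  rw [e1, e1 (fun p => pd n i f p.1 * k (rot n θ p).1), ← integral_const_mul]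
  simp only [rot_rot] at j2 j3 ⊢
  rw [integral_prod _ j2, integral_prod _ (j3.const_mul _)]
  refine integral_congr_ae ?_
  filter_upwards [j1.prod_right_ae, j2.prod_right_ae, j4.prod_right_ae] with z k1 k2 k4
  by_cases hz : k z = 0
  · simp [hz]
  set φ : EuclideanSpace ℝ (Fin n) → ℝ := fun w => f (rot n (-θ) (z, w)).1 with hφ
  have hd : ∀ w, HasFDerivAt φ
      (- sin θ • fderiv ℝ f (rot n (-θ) (z, w)).1) w := by
    intro w
    have d1 : HasFDerivAt (fun w : EuclideanSpace ℝ (Fin n) => (rot n (-θ) (z, w)).1)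
        (- sin θ • ContinuousLinearMap.id ℝ _) w := by
      simp only [rot, sin_neg]
      exact ((hasFDerivAt_id w).const_smul (-sin θ)).const_add _
    have d2 := ((hf.differentiable (by norm_num)) (rot n (-θ) (z, w)).1).hasFDerivAt.comp w d1
    refine d2.congr_fderiv ?_
    ext v
    simp
  have hpd : ∀ w, fderiv ℝ φ w (EuclideanSpace.single i 1) =
      - sin θ * pd n i f (rot n (-θ) (z, w)).1 := by
    intro w; rw [(hd w).fderiv]; simp [pd]
  have := gauss_ibp n i φ (fun w => (hd w).differentiableAt) k1 ?_ ?_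
  · simp_rw [hpd] at this
    have l1 : ∀ w : EuclideanSpace ℝ (Fin n), f (rot n (-θ) (z, w)).1 * (k z * w i) =
        k z * (φ w * w i) := fun w => by simp only [hφ]; ring
    have l2 : ∀ w : EuclideanSpace ℝ (Fin n),
      -sin θ * (pd n i f (rot n (-θ) (z, w)).1 * k z) =
        k z * (- sin θ * pd n i f (rot n (-θ) (z, w)).1) := fun w => by ring
    simp only [l1, l2]
    rw [integral_const_mul (k z), this, ← integral_const_mul (k z)]
  · refine (k2.const_mul (k z)⁻¹).congr (Filter.Eventually.of_forall fun w => ?_)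
    simp only [hφ]; field_simp
  · simp_rw [hpd]
    exact k4.const_mul _

/-- First order covariance identity. -/
lemma first_order {n : ℕ} {f g : EuclideanSpace ℝ (Fin n) → ℝ} (hf : ContDiff ℝ 1 f)
    (hg : ContDiff ℝ 1 g) (hf1 : ∀ i, MemLp (pd n i f) 2 (stdGaussian n))
    (hg1 : ∀ i, MemLp (pd n i g) 2 (stdGaussian n)) (β : ℝ) (hβ : β ≤ π / 2) :
    T n β f g = T n (π/2) f g +
      ∫ α in Set.Ioc β (π/2), sin α * ∑ i, T n α (pd n i f) (pd n i g) := by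
  have hf0 := memLp_of_grad hf hf1
  have hg0 := memLp_of_grad hg hg1
  have h_int := ((hf0.comp_fst (stdGaussian n)).comp_snd
    (volume.restrict (Set.Ioc β (π/2)))).integrable_mul (memLp_rotp β (π/2) (memLp_Sder hg1))
  have e : T n (π/2) f g - T n β f g =
      ∫ p, (∫ α in Set.Ioc β (π/2), f p.1 * Sder n g (rot n α p)) ∂(gg n) := by
    unfold T
    rw [← integral_sub (T_integrable _ hf0 hg0) (T_integrable _ hf0 hg0)]
    refine integral_congr_ae (Filter.Eventually.of_forall fun p => ?_)
    simp only
    rw [integral_const_mul, ← intervalIntegral.integral_of_le hβ, ftc hg]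
    ring
  have sw : ∫ p, (∫ α in Set.Ioc β (π/2), f p.1 * Sder n g (rot n α p)) ∂(gg n) =
      ∫ α in Set.Ioc β (π/2), ∫ p, f p.1 * Sder n g (rot n α p) ∂(gg n) :=
    (integral_integral_swap (f := fun α p => f p.1 * Sder n g (rot n α p)) h_int).symm
  have fin : ∀ α, ∫ p, f p.1 * Sder n g (rot n α p) ∂(gg n) =
      - (sin α * ∑ i, T n α (pd n i f) (pd n i g)) := by
    intro α
    unfold Sder
    simp_rw [Finset.mul_sum]
    rw [integral_finsetSum]
    · simp_rw [rot_ibp α hf _ hf0 (hf1 _) (hg1 _)]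
      rw [← Finset.sum_neg_distrib]
      simp
    · intro i _
      exact (hf0.comp_fst (stdGaussian n)).integrable_mul (memLp_rot α (memLp_mulcoord (hg1 i) i))
  rw [sw] at e
  simp_rw [fin] at e
  rw [integral_neg] at e
  linarith

end GCov

open MeasureTheory Real
open scoped RealInnerProductSpace

namespace GCov

/-- The Mehler density. -/
noncomputable def mehler (n : ℕ) (t : ℝ) (x y : EuclideanSpace ℝ (Fin n)) : ℝ :=
  (2 * π) ^ (-(n : ℝ)) * ((1 - t ^ 2) ^ (-(n : ℝ) / 2) *
        Real.exp (-(‖x‖ ^ 2 + ‖y‖ ^ 2 - 2 * t * ⟪x, y⟫) / (2 * (1 - t ^ 2))))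

lemma mehler_meas (n : ℕ) : Measurable (fun q : ℝ × (EuclideanSpace ℝ (Fin n) ×
    EuclideanSpace ℝ (Fin n)) => mehler n q.1 q.2.1 q.2.2) := by
  unfold mehler; fun_prop

lemma mehler_meas' (n : ℕ) (t : ℝ) : Measurable (fun q : (EuclideanSpace ℝ (Fin n) ×
    EuclideanSpace ℝ (Fin n)) => mehler n t q.1 q.2) := by
  unfold mehler; fun_prop

lemma mehler_nonneg (n : ℕ) {t : ℝ} (ht : 0 ≤ 1 - t ^ 2) (x y) : 0 ≤ mehler n t x y := by
  unfold mehler; positivity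

lemma mehler_eq (n : ℕ) {c s : ℝ} (hs : 0 < s) (hcs : c ^ 2 + s ^ 2 = 1)
    (x y : EuclideanSpace ℝ (Fin n)) :
    rho n x * ((s ^ n)⁻¹ * rho n (s⁻¹ • (y - c • x))) = mehler n c x y := by
  have hs2 : 1 - c ^ 2 = s ^ 2 := by linarith
  unfold rho mehler
  rw [hs2]
  have e1 : (s ^ 2) ^ (-(n:ℝ)/2) = (s ^ n)⁻¹ := by
    rw [← Real.rpow_natCast s 2, ← Real.rpow_mul hs.le]
    rw [show ((2:ℕ):ℝ) * (-(n:ℝ)/2) = -(n:ℝ) by push_cast; ring, Real.rpow_neg hs.le,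
      Real.rpow_natCast]
  have e2 : (2 * π) ^ (-(n:ℝ)) = (2 * π) ^ (-(n:ℝ)/2) * (2 * π) ^ (-(n:ℝ)/2) := by
    rw [← Real.rpow_add (by positivity)]; congr 1; ring
  have e3 : -(‖x‖ ^ 2 + ‖y‖ ^ 2 - 2 * c * ⟪x, y⟫) / (2 * s ^ 2) =
      -‖x‖^2/2 + -‖s⁻¹ • (y - c • x)‖^2/2 := by
    rw [norm_smul, mul_pow, norm_sub_sq_real, norm_smul, inner_smul_right, real_inner_comm,
      mul_pow, Real.norm_eq_abs, Real.norm_eq_abs, sq_abs, sq_abs]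
    field_simp
    have : c^2 = 1 - s^2 := by linarith
    rw [this]; ring
  rw [e1, e2, e3, Real.exp_add]
  ring

lemma lintegral_affine (n : ℕ) {s : ℝ} (hs : 0 < s) (a : EuclideanSpace ℝ (Fin n))
    (K : EuclideanSpace ℝ (Fin n) → ENNReal) (hK : Measurable K) :
    ∫⁻ w, K (a + s • w) = ENNReal.ofReal ((s ^ n)⁻¹) * ∫⁻ y, K y := by
  have h1 : ∫⁻ w, K (a + s • w) = ∫⁻ w, (fun z => K (a + z)) w
      ∂(Measure.map (fun w : EuclideanSpace ℝ (Fin n) => s • w) volume) := by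
    rw [lintegral_map (by fun_prop) (by fun_prop)]
  have h2 := Measure.map_addHaar_smul (volume : Measure (EuclideanSpace ℝ (Fin n))) hs.ne'
  rw [h1, show (fun w : EuclideanSpace ℝ (Fin n) => s • w) = (s • ·) from rfl, h2,
    lintegral_smul_measure, lintegral_add_left_eq_self]
  simp [abs_of_pos hs]

lemma map_eq (n : ℕ) {c s : ℝ} (hs : 0 < s) (hcs : c ^ 2 + s ^ 2 = 1) :
    (gg n).map (fun p => (p.1, c • p.1 + s • p.2)) =
      (volume.prod volume).withDensity (fun z => ENNReal.ofReal (mehler n c z.1 z.2)) := by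
  have hr : Measurable (fun x => ENNReal.ofReal (rho n x)) :=
    (rho_cont n).measurable.ennreal_ofReal
  refine Measure.ext fun A hA => ?_
  have hG : Measurable (A.indicator (1 : EuclideanSpace ℝ (Fin n) × EuclideanSpace ℝ (Fin n) → ENNReal)) :=
    measurable_one.indicator hA
  set G := A.indicator (1 : EuclideanSpace ℝ (Fin n) × EuclideanSpace ℝ (Fin n) → ENNReal) with hGd
  have hm : Measurable (fun p : EuclideanSpace ℝ (Fin n) × EuclideanSpace ℝ (Fin n) =>
    (p.1, c • p.1 + s • p.2)) := by fun_prop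
  rw [← lintegral_indicator_one hA, ← lintegral_indicator_one hA, ← hGd,
    lintegral_map hG hm, lintegral_prod (fun a => G (a.1, c • a.1 + s • a.2)) (hG.comp hm).aemeasurable,
    lintegral_withDensity_eq_lintegral_mul _ (mehler_meas' n c).ennreal_ofReal hG,
    lintegral_prod _ ((mehler_meas' n c).ennreal_ofReal.mul hG).aemeasurable]
  rw [std_eq, lintegral_withDensity_eq_lintegral_mul _ hr
    (by exact (hG.comp hm).lintegral_prod_right')]
  refine lintegral_congr fun x => ?_
  have hGx : Measurable (fun y => G (x, y)) := hG.comp (by fun_prop)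
  simp only [Pi.mul_apply]
  rw [lintegral_withDensity_eq_lintegral_mul _ hr (by exact hGx.comp (by fun_prop))]
  have h1 : ∀ w : EuclideanSpace ℝ (Fin n),
      ((fun x => ENNReal.ofReal (rho n x)) * fun y => G (x, c • x + s • y)) w =
      (fun y => ENNReal.ofReal (rho n (s⁻¹ • (y - c • x))) * G (x, y)) (c • x + s • w) := by
    intro w
    simp [smul_smul, inv_mul_cancel₀ hs.ne']
  simp_rw [h1]
  rw [lintegral_affine n hs _ (fun y => ENNReal.ofReal (rho n (s⁻¹ • (y - c • x))) * G (x, y))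
    ((hr.comp (by fun_prop)).mul hGx), ← mul_assoc,
    ← lintegral_const_mul' _ _ (by finiteness)]
  refine lintegral_congr fun y => ?_
  rw [← mehler_eq n hs hcs, ENNReal.ofReal_mul (rho_pos n x).le,
    ENNReal.ofReal_mul (by positivity)]
  ring

lemma T_eq_mehler {n : ℕ} {θ : ℝ} (hθ : θ ∈ Set.Ioo 0 (π/2)) {h k : EuclideanSpace ℝ (Fin n) → ℝ}
    (hc : Continuous h) (kc : Continuous k)
    (hh : MemLp h 2 (stdGaussian n)) (hk : MemLp k 2 (stdGaussian n)) :
    Integrable (fun z : EuclideanSpace ℝ (Fin n) × EuclideanSpace ℝ (Fin n) =>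
      h z.1 * k z.2 * mehler n (cos θ) z.1 z.2) (volume.prod volume) ∧
    T n θ h k = ∫ z : EuclideanSpace ℝ (Fin n) × EuclideanSpace ℝ (Fin n),
      h z.1 * k z.2 * mehler n (cos θ) z.1 z.2 ∂(volume.prod volume) := by
  have hs : 0 < sin θ := sin_pos_of_pos_of_lt_pi hθ.1 (by have := hθ.2; linarith [pi_pos])
  have hcs : cos θ ^ 2 + sin θ ^ 2 = 1 := by rw [add_comm]; exact sin_sq_add_cos_sq θ
  have hm := map_eq n hs hcs
  have hi := T_integrable θ hh hk
  have hphi : Measurable (fun p : EuclideanSpace ℝ (Fin n) × EuclideanSpace ℝ (Fin n) =>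
    (p.1, cos θ • p.1 + sin θ • p.2)) := by fun_prop
  have hfm : ∀ μ : Measure (EuclideanSpace ℝ (Fin n) × EuclideanSpace ℝ (Fin n)),
    AEStronglyMeasurable (fun z : EuclideanSpace ℝ (Fin n) × EuclideanSpace ℝ (Fin n) =>
      h z.1 * k z.2) μ := fun μ => by
        have : Continuous (fun z : EuclideanSpace ℝ (Fin n) × EuclideanSpace ℝ (Fin n) =>
          h z.1 * k z.2) := by fun_prop
        exact this.aestronglyMeasurable
  have hnn : ∀ z : EuclideanSpace ℝ (Fin n) × EuclideanSpace ℝ (Fin n),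
      0 ≤ mehler n (cos θ) z.1 z.2 := fun z => mehler_nonneg n (by nlinarith) _ _
  have hdm := ((mehler_meas' n (cos θ)).ennreal_ofReal.aemeasurable
    (μ := (volume.prod volume : Measure (EuclideanSpace ℝ (Fin n) × EuclideanSpace ℝ (Fin n)))))
  have hlt : ∀ᵐ z ∂(volume.prod volume : Measure (EuclideanSpace ℝ (Fin n) × EuclideanSpace ℝ (Fin n))),
    ENNReal.ofReal (mehler n (cos θ) z.1 z.2) < ⊤ := Filter.Eventually.of_forall fun x => ENNReal.ofReal_lt_top
  constructor
  · have h2 := (integrable_map_measure (hfm _) hphi.aemeasurable).2 hi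
    rw [hm, integrable_withDensity_iff_integrable_smul₀' hdm hlt] at h2
    refine h2.congr (Filter.Eventually.of_forall fun z => ?_)
    simp [ENNReal.toReal_ofReal (hnn z), mul_comm]
  · have h2 := integral_map hphi.aemeasurable (hfm ((gg n).map _))
    rw [hm, integral_withDensity_eq_integral_toReal_smul₀ hdm hlt] at h2
    refine h2.symm.trans (integral_congr_ae (Filter.Eventually.of_forall fun z => ?_))
    simp [ENNReal.toReal_ofReal (hnn z), mul_comm]

lemma T_abs_le {n : ℕ} (θ : ℝ) {h k : EuclideanSpace ℝ (Fin n) → ℝ}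
    (hh : MemLp h 2 (stdGaussian n)) (hk : MemLp k 2 (stdGaussian n)) :
    |T n θ h k| ≤ (∫ x, h x ^ 2 ∂(stdGaussian n)) + ∫ x, k x ^ 2 ∂(stdGaussian n) := by
  have i1 := (hh.comp_fst (stdGaussian n)).integrable_sq
  have i2 := (memLp_rot θ (F := fun p => k p.1) (hk.comp_fst (stdGaussian n))).integrable_sq
  have e1 : ∫ p, h p.1 ^ 2 ∂(gg n) = ∫ x, h x ^ 2 ∂(stdGaussian n) := by
    rw [integral_fun_fst (f := fun x => h x ^ 2)]; simp
  have e2 : ∫ p, k (rot n θ p).1 ^ 2 ∂(gg n) = ∫ x, k x ^ 2 ∂(stdGaussian n) := by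
    rw [(rot_mp' n θ).integral_comp (rot_emb n θ) (fun p => k p.1 ^ 2),
      integral_fun_fst (f := fun x => k x ^ 2)]; simp
  rw [← e1, ← e2, ← integral_add i1 i2]
  refine (abs_integral_le_integral_abs).trans (integral_mono (T_integrable θ hh hk).abs (i1.add i2) ?_)
  intro p
  simp only [abs_mul]
  nlinarith [sq_nonneg (|h p.1| - |k (rot n θ p).1|), sq_abs (h p.1), sq_abs (k (rot n θ p).1),
    abs_nonneg (h p.1), abs_nonneg (k (rot n θ p).1)]

lemma arccos_mem {t : ℝ} (ht : t ∈ Set.Ioo (0:ℝ) 1) : arccos t ∈ Set.Ioo 0 (π/2) :=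
  ⟨arccos_pos.2 ht.2, by rw [arccos_lt_pi_div_two]; exact ht.1⟩

lemma cos_arccos' {t : ℝ} (ht : t ∈ Set.Ioo (0:ℝ) 1) : cos (arccos t) = t :=
  cos_arccos (by linarith [ht.1]) ht.2.le

lemma triple_integrable {n : ℕ} {h k : EuclideanSpace ℝ (Fin n) → ℝ}
    (hc : Continuous h) (kc : Continuous k)
    (hh : MemLp h 2 (stdGaussian n)) (hk : MemLp k 2 (stdGaussian n)) :
    Integrable (fun q : ℝ × (EuclideanSpace ℝ (Fin n) × EuclideanSpace ℝ (Fin n)) =>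
      (1 - q.1) * (h q.2.1 * k q.2.2 * mehler n q.1 q.2.1 q.2.2))
      ((volume.restrict (Set.Ioo (0:ℝ) 1)).prod (volume.prod volume)) := by
  have hmeas : Measurable (fun q : ℝ × (EuclideanSpace ℝ (Fin n) × EuclideanSpace ℝ (Fin n)) =>
      (1 - q.1) * (h q.2.1 * k q.2.2 * mehler n q.1 q.2.1 q.2.2)) := by
    have := mehler_meas n
    have h1 := hc.measurable
    have h2 := kc.measurable
    fun_prop
  rw [integrable_prod_iff hmeas.aestronglyMeasurable]
  constructor
  · filter_upwards [ae_restrict_mem measurableSet_Ioo] with t ht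
    have := (T_eq_mehler (arccos_mem ht) hc kc hh hk).1
    rw [cos_arccos' ht] at this
    exact this.const_mul _
  · refine Integrable.mono' (integrable_const ((∫ x, |h x| ^ 2 ∂(stdGaussian n)) +
      ∫ x, |k x| ^ 2 ∂(stdGaussian n))) hmeas.aestronglyMeasurable.norm.integral_prod_right' ?_
    filter_upwards [ae_restrict_mem measurableSet_Ioo] with t ht
    have h1 := (T_eq_mehler (arccos_mem ht) hc.abs kc.abs hh.abs hk.abs).2
    rw [cos_arccos' ht] at h1
    have h2 := T_abs_le (arccos t) hh.abs hk.abs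
    have h3 : ∀ y : EuclideanSpace ℝ (Fin n) × EuclideanSpace ℝ (Fin n),
        ‖(1 - t) * (h y.1 * k y.2 * mehler n t y.1 y.2)‖ =
        (1 - t) * (|h y.1| * |k y.2| * mehler n t y.1 y.2) := by
      intro y
      rw [Real.norm_eq_abs, abs_mul, abs_mul, abs_mul, abs_of_nonneg (by linarith [ht.2] : 0 ≤ 1 - t),
        abs_of_nonneg (mehler_nonneg n (by nlinarith [ht.1, ht.2]) _ _)]
    simp_rw [h3]
    rw [integral_const_mul, ← h1, Real.norm_eq_abs, abs_mul,
      abs_of_nonneg (by linarith [ht.2] : 0 ≤ 1 - t)]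
    refine le_trans ?_ h2
    have := abs_nonneg (T n (arccos t) (fun x => |h x|) (fun x => |k x|))
    exact mul_le_of_le_one_left this (by linarith [ht.1])

lemma qdens_eq (n : ℕ) (x y : EuclideanSpace ℝ (Fin n)) (a : ℝ) :
    a * qdens n x y = ∫ t in Set.Ioo (0:ℝ) 1, (1 - t) * (a * mehler n t x y) := by
  unfold qdens mehler
  rw [← integral_const_mul, ← integral_const_mul]
  congr 1
  ext t
  ring

lemma cov_sub {n : ℕ} (G : ℝ → ℝ) :
    ∫ t in Set.Ioo (0:ℝ) 1, G t = ∫ θ in Set.Ioc (0:ℝ) (π/2), sin θ * G (cos θ) := by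
  have him : cos '' Set.Ioo (0:ℝ) (π/2) = Set.Ioo 0 1 := by
    ext t
    constructor
    · rintro ⟨θ, hθ, rfl⟩
      refine ⟨cos_pos_of_mem_Ioo ⟨by linarith [hθ.1, pi_pos], hθ.2⟩, ?_⟩
      rw [← cos_zero]
      exact cos_lt_cos_of_nonneg_of_le_pi_div_two le_rfl hθ.2.le hθ.1
    · intro ht
      exact ⟨arccos t, arccos_mem ht, cos_arccos' ht⟩
  rw [← him, integral_image_eq_integral_abs_deriv_smul measurableSet_Ioo
    (fun x _ => (hasDerivAt_cos x).hasDerivWithinAt)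
    (injOn_cos.mono (Set.Ioo_subset_Icc_self.trans (Set.Icc_subset_Icc_right (by linarith [pi_pos])))), integral_Ioc_eq_integral_Ioo]
  refine setIntegral_congr_fun measurableSet_Ioo fun x hx => ?_
  have : 0 < sin x := sin_pos_of_pos_of_lt_pi hx.1 (by linarith [hx.2, pi_pos])
  simp [abs_of_pos this]

lemma lemmaB {n : ℕ} {h k : EuclideanSpace ℝ (Fin n) → ℝ}
    (hc : Continuous h) (kc : Continuous k)
    (hh : MemLp h 2 (stdGaussian n)) (hk : MemLp k 2 (stdGaussian n)) :
    Integrable (fun z : EuclideanSpace ℝ (Fin n) × EuclideanSpace ℝ (Fin n) =>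
      h z.1 * k z.2 * qdens n z.1 z.2) (volume.prod volume) ∧
    ∫ z : EuclideanSpace ℝ (Fin n) × EuclideanSpace ℝ (Fin n),
      h z.1 * k z.2 * qdens n z.1 z.2 ∂(volume.prod volume) =
    ∫ θ in Set.Ioc (0:ℝ) (π/2), sin θ * ((1 - cos θ) * T n θ h k) := by
  have ht := triple_integrable hc kc hh hk
  simp_rw [qdens_eq]
  refine ⟨ht.integral_prod_right, ?_⟩
  rw [← integral_integral_swap ht]
  simp_rw [integral_const_mul]
  rw [cov_sub (n := n), integral_Ioc_eq_integral_Ioo, integral_Ioc_eq_integral_Ioo]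
  refine setIntegral_congr_fun measurableSet_Ioo fun x hx => ?_
  rw [(T_eq_mehler hx hc kc hh hk).2]

lemma triangle (χ : ℝ → ℝ) (hχ : Integrable χ (volume.restrict (Set.Ioc 0 (π/2)))) :
    ∫ β in Set.Ioc 0 (π/2), sin β * ∫ α in Set.Ioc β (π/2), sin α * χ α =
    ∫ α in Set.Ioc 0 (π/2), sin α * ((1 - cos α) * χ α) := by
  set ν := (volume.restrict (Set.Ioc 0 (π/2)) : Measure ℝ) with hν
  set K : ℝ → ℝ → ℝ := fun β α => (if β < α then sin β * sin α else 0) * χ α with hK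
  have hKi : Integrable (Function.uncurry K) (ν.prod ν) := by
    refine (hχ.comp_snd ν).bdd_mul (c := 1) ?_ (Filter.Eventually.of_forall fun q => ?_)
    · refine (Measurable.ite (measurableSet_lt measurable_fst measurable_snd)
        (by fun_prop) (by fun_prop)).aestronglyMeasurable
    · split_ifs
      · rw [norm_mul]
        exact mul_le_one₀ (abs_sin_le_one _) (norm_nonneg _) (abs_sin_le_one _)
      · simp
  have sw := integral_integral_swap hKi
  have l : ∫ β, ∫ α, K β α ∂ν ∂ν = ∫ β, (sin β * ∫ α in Set.Ioc β (π/2), sin α * χ α) ∂ν := by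
    refine setIntegral_congr_fun measurableSet_Ioc fun β hβ => ?_
    rw [← integral_const_mul]
    have : ∀ α, K β α = (Set.Ioi β).indicator (fun α => sin β * (sin α * χ α)) α := by
      intro α
      simp only [hK, Set.indicator, Set.mem_Ioi]
      split_ifs <;> ring
    simp_rw [this]
    rw [integral_indicator measurableSet_Ioi, hν, Measure.restrict_restrict measurableSet_Ioi]
    congr 2
    ext x; simp only [Set.mem_inter_iff, Set.mem_Ioi, Set.mem_Ioc]
    exact ⟨fun h => ⟨h.1, h.2.2⟩, fun h => ⟨h.1, hβ.1.trans h.1, h.2⟩⟩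
  have r : ∫ α, ∫ β, K β α ∂ν ∂ν = ∫ α, sin α * ((1 - cos α) * χ α) ∂ν := by
    refine setIntegral_congr_fun measurableSet_Ioc fun α hα => ?_
    simp only [hK]
    rw [integral_mul_const]
    have : ∀ β, (if β < α then sin β * sin α else 0) =
        (Set.Iio α).indicator (fun β => sin β * sin α) β := by
      intro β
      simp only [Set.indicator, Set.mem_Iio]
    simp_rw [this]
    rw [integral_indicator measurableSet_Iio, hν, Measure.restrict_restrict measurableSet_Iio]
    have e : Set.Iio α ∩ Set.Ioc 0 (π/2) = Set.Ioo 0 α := by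
      ext x; simp only [Set.mem_inter_iff, Set.mem_Iio, Set.mem_Ioc, Set.mem_Ioo]
      exact ⟨fun h => ⟨h.2.1, h.1⟩, fun h => ⟨h.2, h.1, h.2.le.trans hα.2⟩⟩
    rw [e, integral_mul_const, ← integral_Ioc_eq_integral_Ioo,
      ← intervalIntegral.integral_of_le hα.1.le, integral_sin, cos_zero]
    ring
  rw [← l, sw, r]

end GCov

open MeasureTheory Real
open scoped RealInnerProductSpace

namespace GCov

lemma int_bdd {w χ : ℝ → ℝ} {ν : Measure ℝ} (hw : Continuous w) (c : ℝ) (hb : ∀ x, ‖w x‖ ≤ c)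
    (hχ : Integrable χ ν) : Integrable (fun x => w x * χ x) ν :=
  hχ.bdd_mul (c := c) hw.aestronglyMeasurable (Filter.Eventually.of_forall hb)

lemma int_sin_cos {χ : ℝ → ℝ} {ν : Measure ℝ} (hχ : Integrable χ ν) :
    Integrable (fun x => sin x * ((1 - cos x) * χ x)) ν := by
  have := int_bdd (w := fun x => sin x * (1 - cos x)) (by fun_prop) 2 (fun x => by
    rw [norm_mul]
    have h1 : ‖sin x‖ ≤ 1 := abs_sin_le_one x
    have h2 : ‖1 - cos x‖ ≤ 2 := by
      rw [Real.norm_eq_abs, abs_le]; constructor <;> linarith [cos_le_one x, neg_one_le_cos x]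
    nlinarith [norm_nonneg (sin x), norm_nonneg (1 - cos x)]) hχ
  simpa [mul_assoc] using this

lemma int_sin {χ : ℝ → ℝ} {ν : Measure ℝ} (hχ : Integrable χ ν) :
    Integrable (fun x => sin x * χ x) ν :=
  int_bdd continuous_sin 1 abs_sin_le_one hχ

lemma second_order {n : ℕ} {f g : EuclideanSpace ℝ (Fin n) → ℝ} (hf : ContDiff ℝ 1 f)
    (hg : ContDiff ℝ 1 g) (hf1 : ∀ i, MemLp (pd n i f) 2 (stdGaussian n))
    (hg1 : ∀ i, MemLp (pd n i g) 2 (stdGaussian n)) :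
    ∫ β in Set.Ioc 0 (π/2), sin β * T n β f g = T n (π/2) f g +
      ∑ i, ∫ z : EuclideanSpace ℝ (Fin n) × EuclideanSpace ℝ (Fin n),
        pd n i f z.1 * pd n i g z.2 * qdens n z.1 z.2 ∂(volume.prod volume) := by
  have hf0 := memLp_of_grad hf hf1
  have hg0 := memLp_of_grad hg hg1
  have hTi := T_integrable_param 0 (π/2) hf0 hg0
  have hTii := fun i => T_integrable_param 0 (π/2) (hf1 i) (hg1 i)
  have e1 : ∀ β ∈ Set.Ioc 0 (π/2), ∫ α in Set.Ioc β (π/2),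
      sin α * ∑ i, T n α (pd n i f) (pd n i g) = T n β f g - T n (π/2) f g := by
    intro β hβ
    rw [first_order hf hg hf1 hg1 β hβ.2]; ring
  have e2 := triangle (fun α => ∑ i, T n α (pd n i f) (pd n i g))
    (integrable_finsetSum _ fun i _ => hTii i)
  rw [setIntegral_congr_fun measurableSet_Ioc (fun β hβ => by
    show _ = sin β * T n β f g - sin β * T n (π/2) f g
    rw [e1 β hβ, mul_sub])] at e2
  have hs : ∫ a in Set.Ioc 0 (π/2), sin a = 1 := by
    rw [← intervalIntegral.integral_of_le (by positivity : (0:ℝ) ≤ π/2), integral_sin]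
    simp
  rw [integral_sub (int_sin hTi) (int_sin (integrable_const _)), integral_mul_const,
    hs] at e2
  simp_rw [Finset.mul_sum] at e2
  rw [integral_finsetSum _ (fun i _ => int_sin_cos (hTii i))] at e2
  simp_rw [fun i => (lemmaB (pd_cont i hf) (pd_cont i hg) (hf1 i) (hg1 i)).2]
  linarith

lemma grad_coord {n : ℕ} (u : EuclideanSpace ℝ (Fin n) → ℝ) (x : EuclideanSpace ℝ (Fin n))
    (i : Fin n) : gradient u x i = pd n i u x := by
  have : ⟪gradient u x, EuclideanSpace.single i (1:ℝ)⟫ = pd n i u x := by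
    unfold gradient pd
    rw [InnerProductSpace.toDual_symm_apply]
  rw [← this, EuclideanSpace.inner_single_right]
  simp

lemma integral_grad {n : ℕ} (u : EuclideanSpace ℝ (Fin n) → ℝ) 
    (h : ∀ i, MemLp (pd n i u) 2 (stdGaussian n)) (i : Fin n) :
    (∫ x, gradient u x ∂(stdGaussian n)) i = ∫ x, pd n i u x ∂(stdGaussian n) := by
  have hi : Integrable (gradient u) (stdGaussian n) := by
    have : gradient u = fun x => ∑ i, pd n i u x • EuclideanSpace.single i (1:ℝ) := by
      ext x j
      simp [grad_coord, Pi.single_apply]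
    rw [this]
    exact integrable_finsetSum _ fun i _ => ((h i).integrable (by norm_num)).smul_const _
  have := (EuclideanSpace.proj (𝕜 := ℝ) i : EuclideanSpace ℝ (Fin n) →L[ℝ] ℝ).integral_comp_comm hi
  refine this.symm.trans (integral_congr_ae (Filter.Eventually.of_forall fun x => ?_))
  exact grad_coord u x i

lemma hess_eq {n : ℕ} {u : EuclideanSpace ℝ (Fin n) → ℝ} (hu : ContDiff ℝ 2 u)
    (x : EuclideanSpace ℝ (Fin n)) (i j : Fin n) :
    hessEntry n u x i j = pd n i (pd n j u) x := by
  have h1 : ContDiff ℝ 1 (fderiv ℝ u) := hu.fderiv_right (by norm_num)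
  have h2 : DifferentiableAt ℝ (fderiv ℝ u) x := h1.differentiable (by norm_num) x
  have h3 := h2.hasFDerivAt.clm_apply (hasFDerivAt_const (EuclideanSpace.single j (1:ℝ)) x)
  unfold hessEntry
  conv_rhs => unfold pd
  rw [h3.fderiv]
  simp

lemma pd_contDiff {n : ℕ} {u : EuclideanSpace ℝ (Fin n) → ℝ} (hu : ContDiff ℝ 2 u) (j : Fin n) :
    ContDiff ℝ 1 (pd n j u) := by
  have h1 : ContDiff ℝ 1 (fderiv ℝ u) := hu.fderiv_right (by norm_num)
  exact h1.clm_apply contDiff_const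

lemma hess_memLp {n : ℕ} {u : EuclideanSpace ℝ (Fin n) → ℝ} (hu : ContDiff ℝ 2 u)
    (hu2 : Integrable (fun x => ∑ i : Fin n, ∑ j : Fin n, hessEntry n u x i j ^ 2)
      (stdGaussian n)) (i j : Fin n) : MemLp (pd n i (pd n j u)) 2 (stdGaussian n) := by
  have hc := pd_cont i (pd_contDiff hu j)
  rw [memLp_two_iff_integrable_sq hc.aestronglyMeasurable]
  refine hu2.mono' (by fun_prop) (Filter.Eventually.of_forall fun x => ?_)
  rw [Real.norm_of_nonneg (sq_nonneg _), ← hess_eq hu]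
  calc _ ≤ ∑ j, hessEntry n u x i j ^ 2 :=
        Finset.single_le_sum (f := fun j => hessEntry n u x i j ^ 2)
          (fun _ _ => sq_nonneg _) (Finset.mem_univ j)
    _ ≤ _ := Finset.single_le_sum (f := fun i => ∑ j, hessEntry n u x i j ^ 2)
          (fun _ _ => Finset.sum_nonneg fun _ _ => sq_nonneg _) (Finset.mem_univ i)

end GCov

open GCov in
/-- Second-order Gaussian covariance identity:
`cov(u,v) = ⟨E∇u, E∇v⟩ + ∫∫ ⟨u''(x), v''(y)⟩_HS q_n(x,y) dx dy`. -/
theorem statement15 (n : ℕ) (hn : 1 ≤ n) (u v : EuclideanSpace ℝ (Fin n) → ℝ)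
    (hu : ContDiff ℝ 2 u) (hv : ContDiff ℝ 2 v)
    (hu2 : Integrable (fun x => ∑ i : Fin n, ∑ j : Fin n, hessEntry n u x i j ^ 2)
      (stdGaussian n))
    (hv2 : Integrable (fun x => ∑ i : Fin n, ∑ j : Fin n, hessEntry n v x i j ^ 2)
      (stdGaussian n)) :
    (∫ x, u x * v x ∂(stdGaussian n)) -
        (∫ x, u x ∂(stdGaussian n)) * (∫ x, v x ∂(stdGaussian n)) =
      ⟪∫ x, gradient u x ∂(stdGaussian n), ∫ x, gradient v x ∂(stdGaussian n)⟫ +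
        ∫ x, (∫ y, (∑ i : Fin n, ∑ j : Fin n,
          hessEntry n u x i j * hessEntry n v y i j) * qdens n x y) := by
  have Hu := hess_memLp hu hu2
  have Hv := hess_memLp hv hv2
  have Cu := pd_contDiff hu
  have Cv := pd_contDiff hv
  have Mu := fun j => memLp_of_grad (Cu j) (fun i => Hu i j)
  have Mv := fun j => memLp_of_grad (Cv j) (fun i => Hv i j)
  have h1 := first_order (hu.of_le (by norm_num)) (hv.of_le (by norm_num)) Mu Mv 0 (by positivity)
  rw [T_zero, T_half] at h1
  rw [h1, add_sub_cancel_left]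
  simp_rw [Finset.mul_sum]
  rw [integral_finsetSum _ (fun j _ => int_sin (T_integrable_param 0 (π/2) (Mu j) (Mv j)))]
  simp_rw [fun j => second_order (Cu j) (Cv j) (fun i => Hu i j) (fun i => Hv i j)]
  rw [Finset.sum_add_distrib]
  congr 1
  · simp_rw [T_half]
    rw [PiLp.inner_apply]
    simp_rw [integral_grad u Mu, integral_grad v Mv]
    simp [mul_comm]
  · have B := fun i j => (lemmaB (pd_cont i (Cu j)) (pd_cont i (Cv j)) (Hu i j) (Hv i j)).1
    have hI : Integrable (fun z : EuclideanSpace ℝ (Fin n) × EuclideanSpace ℝ (Fin n) =>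
        ∑ i, ∑ j, pd n i (pd n j u) z.1 * pd n i (pd n j v) z.2 * qdens n z.1 z.2)
        (volume.prod volume) :=
      integrable_finsetSum _ fun i _ => integrable_finsetSum _ fun j _ => B i j
    simp_rw [hess_eq hu, hess_eq hv, Finset.sum_mul]
    rw [← integral_prod _ hI, integral_finsetSum _
      (fun i _ => integrable_finsetSum _ fun j _ => B i j), Finset.sum_comm]
    refine Finset.sum_congr rfl fun i _ => ?_
    rw [integral_finsetSum _ (fun j _ => B i j)]
end
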